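/- arXiv:2109.06413 — 2 statements merged into one kernel-verified Lean document; each statement's English description precedes it below -/
import Mathlib

section
/- Let A be a finite-dimensional dg algebra over a field k of characteristic zero and M an acyclic dg A-A-bimodule. Suppose there exist an ascending filtration {0} = M_0 ⊂ M_1 ⊂ ⋯ ⊂ M by A-A-subbimodules of M (not necessarily preserved by the differential) with ⋃_{q≥0} M_q = M, and a contracting homotopy h for M with h(M_{q+1}) ⊂ M_q for all q ≥ 0. Then M is pointwisely nilpotent. -/
set_option maxHeartbeats 1000000
set_option synthInstance.maxHeartbeats 400000
set_option linter.unusedVariables false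

noncomputable section

namespace KD

open scoped BigOperators TensorProduct

variable (k : Type) [Field k]

def ε (n : ℤ) : k := if Even n then 1 else -1

def ext0 {X : Type} [Zero X] {n : ℕ} (a : Fin n → X) (m : ℕ) : X :=
  if h : m < n then a ⟨m, h⟩ else 0

def compAtF {X : Type} [Zero X] (p₁ p₂ : ℤ)
    (f : (Fin p₁.toNat → X) → X) (g : (Fin p₂.toNat → X) → X)
    (i : ℕ) (a : Fin (p₁ + p₂ - 1).toNat → X) : X :=
  f (fun j => if (j : ℕ) < i then ext0 a (j : ℕ)
      else if (j : ℕ) = i then g (fun l => ext0 a (i + (l : ℕ)))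
      else ext0 a ((j : ℕ) + p₂.toNat - 1))

structure DGAlgebra (A : Type) [Ring A] [Algebra k A] : Type where
  gr : ℤ → Submodule k A
  one_mem : (1 : A) ∈ gr 0
  mul_mem : ∀ {i j : ℤ} {a b : A}, a ∈ gr i → b ∈ gr j → a * b ∈ gr (i + j)
  isInternal : DirectSum.IsInternal gr
  d : A →ₗ[k] A
  d_sq : ∀ a, d (d a) = 0
  d_mem : ∀ {i : ℤ} {a : A}, a ∈ gr i → d a ∈ gr (i + 1)
  d_leibniz : ∀ {i : ℤ} (a b : A), a ∈ gr i → d (a * b) = d a * b + ε k i • (a * d b)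

variable {A : Type} [Ring A] [Algebra k A]

abbrev Coch (A : Type) [Ring A] [Algebra k A] (p : ℤ) : Type :=
  MultilinearMap k (fun _ : Fin p.toNat => A) A

def cochCast {p q : ℤ} (h : p = q) (f : Coch k A p) : Coch k A q :=
  f.domDomCongr (finCongr (congrArg Int.toNat h))

def IsHomog (R : DGAlgebra k A) (p r : ℤ) (f : Coch k A p) : Prop :=
  ∀ (dg : ℕ → ℤ) (a : ℕ → A), (∀ i, a i ∈ R.gr (dg i)) →
    f (fun i => a (i : ℕ)) ∈ R.gr ((∑ i : Fin p.toNat, dg (i : ℕ)) + r)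

/-- The family `dH` is the Hochschild differential of `(A, d_A)`. -/
def IsHochDiff (R : DGAlgebra k A)
    (dH : ∀ p r : ℤ, Coch k A p →ₗ[k] Coch k A (p + 1)) : Prop :=
  ∀ (p : ℤ), 0 ≤ p → ∀ (r : ℤ) (f : Coch k A p) (dg : ℕ → ℤ) (a : ℕ → A),
    (∀ i, a i ∈ R.gr (dg i)) →
    dH p r f (fun i => a (i : ℕ)) =
      ε k (p + r - 1 + r * dg 0) • (a 0 * f (fun i => a ((i : ℕ) + 1)))
      + ∑ i : Fin p.toNat, ε k (p + r + (i : ℕ)) •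
          f (fun j => if (j : ℕ) < (i : ℕ) then a (j : ℕ)
              else if (j : ℕ) = (i : ℕ) then a (i : ℕ) * a ((i : ℕ) + 1)
              else a ((j : ℕ) + 1))
      + ε k r • (f (fun i => a (i : ℕ)) * a p.toNat)

/-- The family `pd` is the internal differential `∂` induced by `d_A`. -/
def IsIntDiff (R : DGAlgebra k A)
    (pd : ∀ p r : ℤ, Coch k A p →ₗ[k] Coch k A p) : Prop :=
  ∀ (p : ℤ), 0 ≤ p → ∀ (r : ℤ) (f : Coch k A p) (dg : ℕ → ℤ) (a : ℕ → A),
    (∀ i, a i ∈ R.gr (dg i)) →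
    pd p r f (fun i => a (i : ℕ)) =
      R.d (f (fun i => a (i : ℕ)))
      - ε k r • ∑ i : Fin p.toNat,
          ε k (∑ j ∈ Finset.range (i : ℕ), dg j) •
            f (fun j => if (j : ℕ) = (i : ℕ) then R.d (a (i : ℕ)) else a (j : ℕ))

/-- The family `cup` is the cup product of Hochschild cochains. -/
def IsCup (R : DGAlgebra k A)
    (cup : ∀ p₁ r₁ p₂ r₂ : ℤ, Coch k A p₁ →ₗ[k] Coch k A p₂ →ₗ[k] Coch k A (p₁ + p₂)) : Prop :=
  ∀ (p₁ : ℤ), 0 ≤ p₁ → ∀ (p₂ : ℤ), 0 ≤ p₂ → ∀ (r₁ r₂ : ℤ)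
    (f : Coch k A p₁) (g : Coch k A p₂) (dg : ℕ → ℤ) (a : ℕ → A),
    (∀ i, a i ∈ R.gr (dg i)) →
    cup p₁ r₁ p₂ r₂ f g (fun i => a (i : ℕ)) =
      ε k (p₁ * p₂ + r₂ * ((∑ j ∈ Finset.range p₁.toNat, dg j) + p₁)) •
        (f (fun i => a (i : ℕ)) * g (fun j => a (p₁.toNat + (j : ℕ))))

/-- The family `br` is the Gerstenhaber bracket of Hochschild cochains. -/
def IsBracket
    (br : ∀ p₁ r₁ p₂ r₂ : ℤ, Coch k A p₁ →ₗ[k] Coch k A p₂ →ₗ[k] Coch k A (p₁ + p₂ - 1)) : Prop :=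
  ∀ (p₁ r₁ p₂ r₂ : ℤ) (f : Coch k A p₁) (g : Coch k A p₂)
    (a : Fin (p₁ + p₂ - 1).toNat → A),
    br p₁ r₁ p₂ r₂ f g a =
      (∑ i : Fin p₁.toNat,
        ε k ((p₁ - 1) * r₂ + (i : ℕ) * (p₂ - 1)) • compAtF p₁ p₂ ⇑f ⇑g (i : ℕ) a)
      - ε k ((p₁ + r₁ - 1) * (p₂ + r₂ - 1)) •
        ∑ j : Fin p₂.toNat,
          ε k ((p₂ - 1) * r₁ + (j : ℕ) * (p₁ - 1)) •
            compAtF p₂ p₁ ⇑g ⇑f (j : ℕ) (fun m => a (Fin.cast (by omega) m))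

/- Total (sum) Hochschild complex -/

abbrev TotCoch (A : Type) [Ring A] [Algebra k A] : Type := ∀ p : ℕ, Coch k A (p : ℤ)

def TotHomog (R : DGAlgebra k A) (n : ℤ) (c : TotCoch k A) : Prop :=
  ∀ p : ℕ, IsHomog k R p (n - p) (c p)

def TotFinSupp (c : TotCoch k A) : Prop := ∃ N : ℕ, ∀ p ≥ N, c p = 0

/-- The total differential `d_H + ∂` on the sum Hochschild complex,
applied to a total cochain of total degree `n`. -/
def TotD (dH : ∀ p r : ℤ, Coch k A p →ₗ[k] Coch k A (p + 1))
    (pd : ∀ p r : ℤ, Coch k A p →ₗ[k] Coch k A p)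
    (n : ℤ) (c : TotCoch k A) : TotCoch k A :=
  fun p => match p with
  | 0 => pd 0 n (c 0)
  | (q+1) => pd ((q : ℤ) + 1) (n - ((q : ℤ) + 1)) (c (q + 1)) + dH (q : ℤ) (n - q) (c q)

def TotIsCocycle (dH : ∀ p r : ℤ, Coch k A p →ₗ[k] Coch k A (p + 1))
    (pd : ∀ p r : ℤ, Coch k A p →ₗ[k] Coch k A p)
    (n : ℤ) (c : TotCoch k A) : Prop :=
  ∀ p : ℕ, TotD k dH pd n c p = 0

def TotIsCoboundary (R : DGAlgebra k A)
    (dH : ∀ p r : ℤ, Coch k A p →ₗ[k] Coch k A (p + 1))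
    (pd : ∀ p r : ℤ, Coch k A p →ₗ[k] Coch k A p)
    (n : ℤ) (c : TotCoch k A) : Prop :=
  ∃ b : TotCoch k A, TotHomog k R (n - 1) b ∧ TotFinSupp k b ∧
    ∀ p : ℕ, c p = TotD k dH pd (n - 1) b p

/-- Total cup product of total cochains of total degrees `n₁`, `n₂`. -/
def totCup (cup : ∀ p₁ r₁ p₂ r₂ : ℤ, Coch k A p₁ →ₗ[k] Coch k A p₂ →ₗ[k] Coch k A (p₁ + p₂))
    (n₁ n₂ : ℤ) (c c' : TotCoch k A) : TotCoch k A :=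
  fun p => ∑ x ∈ (Finset.range (p + 1)).attach,
    cochCast k (by have := Finset.mem_range.mp x.2; omega)
      (cup (x.1 : ℤ) (n₁ - x.1) ((p - x.1 : ℕ) : ℤ) (n₂ - ((p - x.1 : ℕ) : ℤ))
        (c x.1) (c' (p - x.1)))

/-- Total Gerstenhaber bracket of total cochains of total degrees `n₁`, `n₂`. -/
def totBr (br : ∀ p₁ r₁ p₂ r₂ : ℤ, Coch k A p₁ →ₗ[k] Coch k A p₂ →ₗ[k] Coch k A (p₁ + p₂ - 1))
    (n₁ n₂ : ℤ) (c c' : TotCoch k A) : TotCoch k A :=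
  fun p => ∑ x ∈ (Finset.range (p + 2)).attach,
    cochCast k (by have := Finset.mem_range.mp x.2; omega)
      (br (x.1 : ℤ) (n₁ - x.1) ((p + 1 - x.1 : ℕ) : ℤ) (n₂ - ((p + 1 - x.1 : ℕ) : ℤ))
        (c x.1) (c' (p + 1 - x.1)))

/- ## Differential graded bimodules and Hochschild cochains with coefficients -/

variable {M : Type} [AddCommGroup M] [Module k M]

/-- A dg `A`-`A`-bimodule structure on `M` over a dg algebra `(A, R)`. -/
structure DGBimod (R : DGAlgebra k A) (M : Type) [AddCommGroup M] [Module k M] : Type where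
  gr : ℤ → Submodule k M
  isInternal : DirectSum.IsInternal gr
  actL : A →ₗ[k] M →ₗ[k] M
  actR : A →ₗ[k] M →ₗ[k] M
  actL_one : ∀ m, actL 1 m = m
  actL_mul : ∀ a b m, actL (a * b) m = actL a (actL b m)
  actR_one : ∀ m, actR 1 m = m
  actR_mul : ∀ a b m, actR (a * b) m = actR b (actR a m)
  actLR : ∀ a b m, actR b (actL a m) = actL a (actR b m)
  actL_mem : ∀ {i j : ℤ} {a : A} {m : M}, a ∈ R.gr i → m ∈ gr j → actL a m ∈ gr (i + j)
  actR_mem : ∀ {i j : ℤ} {a : A} {m : M}, a ∈ R.gr i → m ∈ gr j → actR a m ∈ gr (j + i)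
  dM : M →ₗ[k] M
  dM_sq : ∀ m, dM (dM m) = 0
  dM_mem : ∀ {j : ℤ} {m : M}, m ∈ gr j → dM m ∈ gr (j + 1)
  dM_actL : ∀ {i : ℤ} (a : A) (m : M), a ∈ R.gr i →
    dM (actL a m) = actL (R.d a) m + ε k i • actL a (dM m)
  dM_actR : ∀ {j : ℤ} (a : A) (m : M), m ∈ gr j →
    dM (actR a m) = actR a (dM m) + ε k j • actR (R.d a) m

/-- A dg algebra is a dg bimodule over itself. -/
def DGAlgebra.toBimod (R : DGAlgebra k A) : DGBimod k R A where
  gr := R.gr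
  isInternal := R.isInternal
  actL := LinearMap.mul k A
  actR := (LinearMap.mul k A).flip
  actL_one := fun m => one_mul m
  actL_mul := fun a b m => mul_assoc a b m
  actR_one := fun m => mul_one m
  actR_mul := fun a b m => (mul_assoc m a b).symm
  actLR := fun a b m => mul_assoc a m b
  actL_mem := fun ha hm => R.mul_mem ha hm
  actR_mem := fun ha hm => R.mul_mem hm ha
  dM := R.d
  dM_sq := R.d_sq
  dM_mem := R.d_mem
  dM_actL := fun a m ha => R.d_leibniz a m ha
  dM_actR := fun a m hm => R.d_leibniz m a hm

/-- Hochschild `p`-cochains of `A` with values in `M`. -/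
abbrev MCoch (A M : Type) [Ring A] [Algebra k A] [AddCommGroup M] [Module k M]
    (p : ℕ) : Type :=
  MultilinearMap k (fun _ : Fin p => A) M

variable {R : DGAlgebra k A}

/-- `f` is an `M`-valued Hochschild cochain of bidegree `(p, r)`. -/
def IsHomogM (St : DGBimod k R M) (p : ℕ) (r : ℤ) (f : MCoch k A M p) : Prop :=
  ∀ (dg : ℕ → ℤ) (a : ℕ → A), (∀ i, a i ∈ R.gr (dg i)) →
    f (fun i => a (i : ℕ)) ∈ St.gr ((∑ i : Fin p, dg (i : ℕ)) + r)

/-- The family `dHM` is the Hochschild differential with values in the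
dg bimodule `M`. -/
def IsHochDiffM (St : DGBimod k R M)
    (dHM : ∀ (p : ℕ) (r : ℤ), MCoch k A M p →ₗ[k] MCoch k A M (p + 1)) : Prop :=
  ∀ (p : ℕ) (r : ℤ) (f : MCoch k A M p) (dg : ℕ → ℤ) (a : ℕ → A),
    (∀ i, a i ∈ R.gr (dg i)) →
    dHM p r f (fun i => a (i : ℕ)) =
      ε k ((p : ℤ) + r - 1 + r * dg 0) • St.actL (a 0) (f (fun i => a ((i : ℕ) + 1)))
      + ∑ i : Fin p, ε k ((p : ℤ) + r + (i : ℕ)) •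
          f (fun j => if (j : ℕ) < (i : ℕ) then a (j : ℕ)
              else if (j : ℕ) = (i : ℕ) then a (i : ℕ) * a ((i : ℕ) + 1)
              else a ((j : ℕ) + 1))
      + ε k r • St.actR (a p) (f (fun i => a (i : ℕ)))

/-- The family `pdM` is the internal differential `∂` induced by `d_A` and `d_M`. -/
def IsIntDiffM (St : DGBimod k R M)
    (pdM : ∀ (p : ℕ) (r : ℤ), MCoch k A M p →ₗ[k] MCoch k A M p) : Prop :=
  ∀ (p : ℕ) (r : ℤ) (f : MCoch k A M p) (dg : ℕ → ℤ) (a : ℕ → A),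
    (∀ i, a i ∈ R.gr (dg i)) →
    pdM p r f (fun i => a (i : ℕ)) =
      St.dM (f (fun i => a (i : ℕ)))
      - ε k r • ∑ i : Fin p,
          ε k (∑ j ∈ Finset.range (i : ℕ), dg j) •
            f (fun j => if (j : ℕ) = (i : ℕ) then R.d (a (i : ℕ)) else a (j : ℕ))

/-- Recasting an `M`-valued cochain along an equality of arities. -/
def mcochCast {p q : ℕ} (h : p = q) (f : MCoch k A M p) : MCoch k A M q :=
  f.domDomCongr (finCongr h)

/-- Post-composition `H = h∘(−)` on `M`-valued cochains. -/
def Hop (h : M →ₗ[k] M) {p : ℕ} (f : MCoch k A M p) : MCoch k A M p :=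
  h.compMultilinearMap f

/-- The operators `𝔥_j = (H ∘ d_H)^j ∘ H` applied to cochains of bidegree `(p,r)`. -/
def frakh (dHM : ∀ (p : ℕ) (r : ℤ), MCoch k A M p →ₗ[k] MCoch k A M (p + 1))
    (h : M →ₗ[k] M) (p : ℕ) (r : ℤ) : (j : ℕ) → MCoch k A M p → MCoch k A M (p + j)
  | 0, f => Hop k h f
  | (j + 1), f => Hop k h (dHM (p + j) (r - j - 1) (frakh dHM h p r j f))

/-- `h` is a contracting homotopy for the dg bimodule `M` (a degree `-1` map
with `d_M ∘ h + h ∘ d_M = id`). -/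
def IsContracting (St : DGBimod k R M) (h : M →ₗ[k] M) : Prop :=
  (∀ m, St.dM (h m) + h (St.dM m) = m) ∧
  ∀ {j : ℤ} {m : M}, m ∈ St.gr j → h m ∈ St.gr (j - 1)

/-- The acyclic dg bimodule `M` is pointwisely nilpotent: some contracting
homotopy `h` satisfies that for every Hochschild cochain `f` with values in `M`
there is `N` with `𝔥_j f = 0` for all `j > N`. -/
def PointwiseNilpotent (St : DGBimod k R M)
    (dHM : ∀ (p : ℕ) (r : ℤ), MCoch k A M p →ₗ[k] MCoch k A M (p + 1)) : Prop :=
  ∃ h : M →ₗ[k] M, IsContracting k St h ∧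
    ∀ (p : ℕ) (r : ℤ) (f : MCoch k A M p), IsHomogM k St p r f →
      ∃ N : ℕ, ∀ j : ℕ, j > N → frakh k dHM h p r j f = 0

/- Total complex with values in `M` -/

abbrev TotMCoch (A M : Type) [Ring A] [Algebra k A] [AddCommGroup M] [Module k M] : Type :=
  ∀ p : ℕ, MCoch k A M p

def TotHomogM (St : DGBimod k R M) (n : ℤ) (c : TotMCoch k A M) : Prop :=
  ∀ p : ℕ, IsHomogM k St p (n - p) (c p)

def TotFinSuppM (c : TotMCoch k A M) : Prop := ∃ N : ℕ, ∀ p ≥ N, c p = 0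

def TotDM (dHM : ∀ (p : ℕ) (r : ℤ), MCoch k A M p →ₗ[k] MCoch k A M (p + 1))
    (pdM : ∀ (p : ℕ) (r : ℤ), MCoch k A M p →ₗ[k] MCoch k A M p)
    (n : ℤ) (c : TotMCoch k A M) : TotMCoch k A M :=
  fun p => match p with
  | 0 => pdM 0 n (c 0)
  | (q + 1) => pdM (q + 1) (n - ((q : ℤ) + 1)) (c (q + 1)) + dHM q (n - q) (c q)

def TotIsCocycleM (dHM : ∀ (p : ℕ) (r : ℤ), MCoch k A M p →ₗ[k] MCoch k A M (p + 1))
    (pdM : ∀ (p : ℕ) (r : ℤ), MCoch k A M p →ₗ[k] MCoch k A M p)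
    (n : ℤ) (c : TotMCoch k A M) : Prop :=
  ∀ p : ℕ, TotDM k dHM pdM n c p = 0

def TotIsCoboundaryM (St : DGBimod k R M)
    (dHM : ∀ (p : ℕ) (r : ℤ), MCoch k A M p →ₗ[k] MCoch k A M (p + 1))
    (pdM : ∀ (p : ℕ) (r : ℤ), MCoch k A M p →ₗ[k] MCoch k A M p)
    (n : ℤ) (c : TotMCoch k A M) : Prop :=
  ∃ b : TotMCoch k A M, TotHomogM k St (n - 1) b ∧ TotFinSuppM k b ∧
    ∀ p : ℕ, c p = TotDM k dHM pdM (n - 1) b p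

/- Morphisms of dg bimodules, quasi-isomorphisms, mapping cones -/

variable {N : Type} [AddCommGroup N] [Module k N]

/-- Morphism of dg `A`-`A`-bimodules (degree-preserving, chain map, bilinear). -/
def IsBimodHom (StM : DGBimod k R M) (StN : DGBimod k R N) (φ : M →ₗ[k] N) : Prop :=
  (∀ (i : ℤ) (m : M), m ∈ StM.gr i → φ m ∈ StN.gr i)
  ∧ (∀ m, φ (StM.dM m) = StN.dM (φ m))
  ∧ (∀ a m, φ (StM.actL a m) = StN.actL a (φ m))
  ∧ (∀ a m, φ (StM.actR a m) = StN.actR a (φ m))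

/-- `φ` is a quasi-isomorphism of dg bimodules (bijective on cohomology). -/
def IsQuasiIso (StM : DGBimod k R M) (StN : DGBimod k R N) (φ : M →ₗ[k] N) : Prop :=
  (∀ (i : ℤ) (n : N), n ∈ StN.gr i → StN.dM n = 0 →
    ∃ m ∈ StM.gr i, StM.dM m = 0 ∧ ∃ n' ∈ StN.gr (i - 1), φ m - n = StN.dM n')
  ∧ (∀ (i : ℤ) (m : M), m ∈ StM.gr i → StM.dM m = 0 →
    (∃ n' ∈ StN.gr (i - 1), φ m = StN.dM n') →
    ∃ m' ∈ StM.gr (i - 1), m = StM.dM m')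

/-- `(C, SC, inM, inN)` is a model for the mapping cone `Cone(φ) = M[1] ⊕ N`
as a dg `A`-`A`-bimodule. -/
def IsConeModel (StM : DGBimod k R M) (StN : DGBimod k R N) (φ : M →ₗ[k] N)
    {C : Type} [AddCommGroup C] [Module k C] (SC : DGBimod k R C)
    (inM : M →ₗ[k] C) (inN : N →ₗ[k] C) : Prop :=
  Function.Bijective (fun mn : M × N => inM mn.1 + inN mn.2)
  ∧ (∀ m, SC.dM (inM m) = - inM (StM.dM m) + inN (φ m))
  ∧ (∀ n, SC.dM (inN n) = inN (StN.dM n))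
  ∧ (∀ (i : ℤ) (m : M), m ∈ StM.gr (i + 1) → inM m ∈ SC.gr i)
  ∧ (∀ (i : ℤ) (n : N), n ∈ StN.gr i → inN n ∈ SC.gr i)
  ∧ (∀ (i : ℤ) (c : C), c ∈ SC.gr i → ∃ m ∈ StM.gr (i + 1), ∃ n ∈ StN.gr i,
      c = inM m + inN n)
  ∧ (∀ (i : ℤ) (a : A) (m : M), a ∈ R.gr i →
      SC.actL a (inM m) = ε k i • inM (StM.actL a m))
  ∧ (∀ (a : A) (n : N), SC.actL a (inN n) = inN (StN.actL a n))
  ∧ (∀ (a : A) (m : M), SC.actR a (inM m) = inM (StM.actR a m))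
  ∧ (∀ (a : A) (n : N), SC.actR a (inN n) = inN (StN.actR a n))

/-- A bundled model of the mapping cone of `φ`. -/
structure ConeData (StM : DGBimod k R M) (StN : DGBimod k R N) (φ : M →ₗ[k] N) where
  C : Type
  [instAdd : AddCommGroup C]
  [instMod : Module k C]
  SC : DGBimod k R C
  inM : M →ₗ[k] C
  inN : N →ₗ[k] C
  isCone : IsConeModel k StM StN φ SC inM inN

attribute [instance] ConeData.instAdd ConeData.instMod

/-- The mapping cone of `φ` is pointwisely nilpotent. -/
def ConePN (StM : DGBimod k R M) (StN : DGBimod k R N) (φ : M →ₗ[k] N) : Prop :=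
  ∃ D : ConeData k StM StN φ,
    ∃ dHC : ∀ (p : ℕ) (r : ℤ), MCoch k A D.C p →ₗ[k] MCoch k A D.C (p + 1),
      IsHochDiffM k D.SC dHC ∧ PointwiseNilpotent k D.SC dHC

/-- `φ` is weakly cone-nilpotent: its mapping cone is pointwisely nilpotent, or
it admits a right (resp. left) inverse morphism of dg bimodules whose mapping
cone is pointwisely nilpotent. -/
def WeaklyConeNilpotent (StM : DGBimod k R M) (StN : DGBimod k R N) (φ : M →ₗ[k] N) : Prop :=
  ConePN k StM StN φ
  ∨ (∃ ψ : N →ₗ[k] M, IsBimodHom k StN StM ψ ∧ (∀ n, φ (ψ n) = n) ∧ ConePN k StN StM ψ)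
  ∨ (∃ ψ : N →ₗ[k] M, IsBimodHom k StN StM ψ ∧ (∀ m, ψ (φ m) = m) ∧ ConePN k StN StM ψ)

/-- A multilinear map takes values in `P` as soon as it does so on tuples of basis vectors. -/
theorem multilinear_mem_of_basis {n : ℕ} {ι : Type} (b : Module.Basis ι k A)
    (P : Submodule k M) (g : MCoch k A M n)
    (hg : ∀ v : Fin n → ι, g (fun i => b (v i)) ∈ P) (x : Fin n → A) : g x ∈ P := by
  have hzero : P.mkQ.compMultilinearMap g = 0 :=
    Module.Basis.ext_multilinear (fun _ => b) fun v => by simpa using hg v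
  simpa using congrArg (fun φ => φ x) hzero

/-- A multilinear map takes values in `P` as soon as it does so on tuples of homogeneous
elements. -/
theorem multilinear_mem_of_homogeneous (R : DGAlgebra k A) {n : ℕ}
    (P : Submodule k M) (g : MCoch k A M n)
    (hg : ∀ (dg : ℕ → ℤ) (a : ℕ → A), (∀ i, a i ∈ R.gr (dg i)) →
      g (fun i => a (i : ℕ)) ∈ P) (x : Fin n → A) : g x ∈ P := by
  let b := R.isInternal.collectedBasis fun i => Module.Basis.ofVectorSpace k (R.gr i)
  refine multilinear_mem_of_basis k b P g (fun v => ?_) x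
  have key := hg (fun i => if hi : i < n then (v ⟨i, hi⟩).1 else 0)
    (fun i => if hi : i < n then b (v ⟨i, hi⟩) else 0) (fun i => by
      by_cases hi : i < n
      · simp only [hi, dif_pos]
        exact R.isInternal.collectedBasis_mem _ _
      · simp [hi])
  simpa using key

/-- The values of a cochain on a finite-dimensional algebra lie in one step of an exhaustive
filtration. -/
theorem exists_forall_mem_filtration [FiniteDimensional k A] {F : ℕ → Submodule k M}
    (hF : Monotone F) (hFunion : ∀ m : M, ∃ q : ℕ, m ∈ F q) {n : ℕ} (f : MCoch k A M n) :
    ∃ q : ℕ, ∀ x, f x ∈ F q := by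
  let b := Module.finBasis k A
  choose q hq using fun v : Fin n → Fin (Module.finrank k A) => hFunion (f fun i => b (v i))
  exact ⟨Finset.univ.sup q, multilinear_mem_of_basis k b _ f fun v =>
    hF (Finset.le_sup (Finset.mem_univ v)) (hq v)⟩

/-- The Hochschild differential preserves cochains with values in a subbimodule. -/
theorem hochDiff_mem {St : DGBimod k R M}
    {dHM : ∀ (p : ℕ) (r : ℤ), MCoch k A M p →ₗ[k] MCoch k A M (p + 1)}
    (hdHM : IsHochDiffM k St dHM) {P : Submodule k M}
    (hL : ∀ (a : A) (m : M), m ∈ P → St.actL a m ∈ P)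
    (hR : ∀ (a : A) (m : M), m ∈ P → St.actR a m ∈ P)
    (p : ℕ) (r : ℤ) {f : MCoch k A M p} (hf : ∀ x, f x ∈ P) (x : Fin (p + 1) → A) :
    dHM p r f x ∈ P := by
  refine multilinear_mem_of_homogeneous k R P _ (fun dg a ha => ?_) x
  rw [hdHM p r f dg a ha]
  exact P.add_mem
    (P.add_mem (P.smul_mem _ (hL _ _ (hf _))) (P.sum_mem fun i _ => P.smul_mem _ (hf _)))
    (P.smul_mem _ (hR _ _ (hf _)))

/-- Each factor of `H` in `𝔥_j` lowers the filtration of the values by one step. -/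
theorem frakh_mem_filtration {St : DGBimod k R M}
    {dHM : ∀ (p : ℕ) (r : ℤ), MCoch k A M p →ₗ[k] MCoch k A M (p + 1)}
    (hdHM : IsHochDiffM k St dHM) {F : ℕ → Submodule k M}
    (hL : ∀ (q : ℕ) (a : A) (m : M), m ∈ F q → St.actL a m ∈ F q)
    (hR : ∀ (q : ℕ) (a : A) (m : M), m ∈ F q → St.actR a m ∈ F q)
    {h : M →ₗ[k] M} (hh : ∀ (q : ℕ) (m : M), m ∈ F q → h m ∈ F (q - 1))
    (p : ℕ) (r : ℤ) {f : MCoch k A M p} {q : ℕ} (hf : ∀ x, f x ∈ F q) (j : ℕ) :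
    ∀ x, frakh k dHM h p r j f x ∈ F (q - (j + 1)) := by
  induction j with
  | zero => exact fun x => hh q _ (hf x)
  | succ j ih =>
    exact fun x => hh _ _ (hochDiff_mem k hdHM (hL _) (hR _) (p + j) (r - j - 1) ih x)

/-- Let `A` be a finite-dimensional dg algebra over a field `k`
of characteristic zero and `M` an acyclic dg `A`-`A`-bimodule.  If there exist
an ascending filtration `{0} = M_0 ⊆ M_1 ⊆ ⋯ ⊆ M` by `A`-`A`-subbimodules (not
necessarily preserved by the differential) with `⋃ M_q = M`, and a contracting
homotopy `h` for `M` with `h(M_{q+1}) ⊆ M_q` for all `q`, then `M` is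
pointwisely nilpotent. -/
theorem statement7
    (k : Type) [Field k] [CharZero k]
    (A : Type) [Ring A] [Algebra k A] [FiniteDimensional k A]
    (M : Type) [AddCommGroup M] [Module k M]
    (R : KD.DGAlgebra k A) (St : KD.DGBimod k R M)
    (hacyclic : ∀ m : M, St.dM m = 0 → ∃ m' : M, m = St.dM m')
    (dHM : ∀ (p : ℕ) (r : ℤ), KD.MCoch k A M p →ₗ[k] KD.MCoch k A M (p + 1))
    (hdHM : KD.IsHochDiffM k St dHM)
    (F : ℕ → Submodule k M)
    (hF0 : F 0 = ⊥)
    (hFmono : ∀ q : ℕ, F q ≤ F (q + 1))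
    (hFactL : ∀ (q : ℕ) (a : A) (m : M), m ∈ F q → St.actL a m ∈ F q)
    (hFactR : ∀ (q : ℕ) (a : A) (m : M), m ∈ F q → St.actR a m ∈ F q)
    (hFunion : ∀ m : M, ∃ q : ℕ, m ∈ F q)
    (h : M →ₗ[k] M) (hh : KD.IsContracting k St h)
    (hhF : ∀ (q : ℕ) (m : M), m ∈ F (q + 1) → h m ∈ F q) :
    KD.PointwiseNilpotent k St dHM := by
  have hlower : ∀ (q : ℕ) (m : M), m ∈ F q → h m ∈ F (q - 1) := by
    rintro (_ | q) m hm
    · rw [hF0, Submodule.mem_bot] at hm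
      simp [hm]
    · exact hhF q m hm
  refine ⟨h, hh, fun p r f _ => ?_⟩
  obtain ⟨q, hq⟩ :=
    exists_forall_mem_filtration k (monotone_nat_of_le_succ hFmono) hFunion f
  refine ⟨q, fun j hj => MultilinearMap.ext fun x => ?_⟩
  have hx := frakh_mem_filtration k hdHM hFactL hFactR hlower p r hq j x
  rw [Nat.sub_eq_zero_of_le (by omega), hF0, Submodule.mem_bot] at hx
  exact hx
end KD
end
end

section
/- Let A be a dg algebra over a field k of characteristic zero and let φ: M → N be a quasi-isomorphism of dg A-A-bimodules. If φ is weakly cone-nilpotent, then the induced map φ_*: Hoch_⊕^•(A,M) → Hoch_⊕^•(A,N) between the sum Hochschild cochain complexes is a quasi-isomorphism. -/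
set_option maxHeartbeats 1000000
set_option synthInstance.maxHeartbeats 400000
set_option linter.unusedVariables false

noncomputable section

namespace KD

open scoped BigOperators TensorProduct

variable (k : Type) [Field k]

variable {A : Type} [Ring A] [Algebra k A]

/- ## Differential graded bimodules and Hochschild cochains with coefficients -/

variable {M : Type} [AddCommGroup M] [Module k M]

variable {R : DGAlgebra k A}

/- Morphisms of dg bimodules, quasi-isomorphisms, mapping cones -/

variable {N : Type} [AddCommGroup N] [Module k N]

section Signs

theorem ε_add (m n : ℤ) : ε k (m + n) = ε k m * ε k n := by
  unfold ε
  by_cases hm : Even m <;> by_cases hn : Even n <;> simp [Int.even_add, hm, hn]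

theorem ε_zero : ε k 0 = 1 := by simp [ε]

theorem ε_one : ε k 1 = -1 := by simp [ε]

theorem ε_neg (m : ℤ) : ε k (-m) = ε k m := by simp [ε]

theorem ε_sub (m n : ℤ) : ε k (m - n) = ε k m * ε k n := by
  rw [sub_eq_add_neg, ε_add, ε_neg]

theorem ε_mul_self (m : ℤ) : ε k m * ε k m = 1 := by
  unfold ε
  split_ifs <;> simp

end Signs

section GradedSign

variable {V : Type} [AddCommGroup V] [Module k V]

/-- The linear map multiplying the degree `i` component of a graded module by `(-1)^(r * i)`. -/
def gradedSign {gr : ℤ → Submodule k V} (hgr : DirectSum.IsInternal gr) (r : ℤ) : V →ₗ[k] V :=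
  (DirectSum.toModule k ℤ V fun i => ε k (r * i) • (gr i).subtype) ∘ₗ
    (LinearEquiv.ofBijective (DirectSum.coeLinearMap gr) hgr).symm.toLinearMap

theorem gradedSign_apply {gr : ℤ → Submodule k V} (hgr : DirectSum.IsInternal gr) (r : ℤ)
    {i : ℤ} {v : V} (hv : v ∈ gr i) : gradedSign k hgr r v = ε k (r * i) • v := by
  have h : (LinearEquiv.ofBijective (DirectSum.coeLinearMap gr) hgr).symm v =
      DirectSum.lof k ℤ (fun i => gr i) i ⟨v, hv⟩ := by
    rw [LinearEquiv.symm_apply_eq]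
    exact (DirectSum.coeLinearMap_lof gr i ⟨v, hv⟩).symm
  simp [gradedSign, h, DirectSum.toModule_lof]

end GradedSign

section HomogeneousSequences

/-- All the entries of the sequence `a` are homogeneous. -/
def IsHomogSeq (R : DGAlgebra k A) (a : ℕ → A) : Prop := ∀ i, ∃ d, a i ∈ R.gr d

variable {k}

/-- Multilinear maps agreeing on homogeneous sequences are equal. -/
theorem MCoch.ext_of_homogSeq (R : DGAlgebra k A) {p : ℕ} {f g : MCoch k A M p}
    (h : ∀ a : ℕ → A, IsHomogSeq k R a → f (fun i => a i) = g (fun i => a i)) : f = g := by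
  classical
  suffices H : ∀ (s : Finset (Fin p)) (a : Fin p → A), (∀ i ∉ s, ∃ d, a i ∈ R.gr d) →
      f a = g a by
    ext a
    exact H Finset.univ a (by simp)
  intro s
  induction s using Finset.induction_on with
  | empty =>
    intro a ha
    have := h (ext0 a) (fun i => by
      unfold ext0
      split_ifs with hi
      · exact ha _ (by simp)
      · exact ⟨0, Submodule.zero_mem _⟩)
    simpa [ext0] using this
  | insert i s hi ih =>
    intro a ha
    have key : ∀ x : A, f (Function.update a i x) = g (Function.update a i x) := by
      intro x
      have hx : x ∈ iSup R.gr := by rw [R.isInternal.submodule_iSup_eq_top]; trivial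
      induction hx using Submodule.iSup_induction' with
      | mem d x hx =>
        refine ih _ fun j hj => ?_
        by_cases hji : j = i
        · subst hji; exact ⟨d, by simpa using hx⟩
        · rw [Function.update_of_ne hji]; exact ha j (by simp [hji, hj])
      | zero => simp [MultilinearMap.map_update_zero]
      | add x y _ _ hx hy => rw [MultilinearMap.map_update_add, MultilinearMap.map_update_add, hx, hy]
    simpa using key (a i)

/-- The sequence obtained from `a` by multiplying the entries `m` and `m + 1`. -/
def mergeAt (m : ℕ) (a : ℕ → A) : ℕ → A := fun j =>
  if j < m then a j else if j = m then a m * a (m + 1) else a (j + 1)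

/-- The sequence obtained from `a` by applying `d_A` to the entry `j`, and the Koszul sign
to all the previous entries. -/
def diffAt (R : DGAlgebra k A) (j : ℕ) (a : ℕ → A) : ℕ → A := fun l =>
  if l < j then gradedSign k R.isInternal 1 (a l) else if l = j then R.d (a j) else a l

theorem exists_gradedSign_mem (R : DGAlgebra k A) (r : ℤ) {x : A} (hx : ∃ d, x ∈ R.gr d) :
    ∃ d, gradedSign k R.isInternal r x ∈ R.gr d := by
  obtain ⟨d, hd⟩ := hx
  exact ⟨d, by rw [gradedSign_apply k R.isInternal r hd]; exact Submodule.smul_mem _ _ hd⟩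

theorem IsHomogSeq.tail {R : DGAlgebra k A} {a : ℕ → A} (ha : IsHomogSeq k R a) :
    IsHomogSeq k R (fun j => a (j + 1)) := fun i => ha (i + 1)

theorem IsHomogSeq.mergeAt {R : DGAlgebra k A} {a : ℕ → A} (ha : IsHomogSeq k R a) (m : ℕ) :
    IsHomogSeq k R (mergeAt m a) := fun i => by
  unfold KD.mergeAt
  split_ifs
  · exact ha i
  · obtain ⟨d, hd⟩ := ha m
    obtain ⟨e, he⟩ := ha (m + 1)
    exact ⟨_, R.mul_mem hd he⟩
  · exact ha _

theorem IsHomogSeq.diffAt {R : DGAlgebra k A} {a : ℕ → A} (ha : IsHomogSeq k R a) (j : ℕ) :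
    IsHomogSeq k R (diffAt R j a) := fun i => by
  unfold KD.diffAt
  split_ifs
  · exact exists_gradedSign_mem R 1 (ha i)
  · obtain ⟨d, hd⟩ := ha j
    exact ⟨_, R.d_mem hd⟩
  · exact ha _

theorem gradedSign_mul (R : DGAlgebra k A) (r : ℤ) {x y : A} (hx : ∃ d, x ∈ R.gr d)
    (hy : ∃ d, y ∈ R.gr d) : gradedSign k R.isInternal r (x * y) =
      gradedSign k R.isInternal r x * gradedSign k R.isInternal r y := by
  obtain ⟨d, hd⟩ := hx
  obtain ⟨e, he⟩ := hy
  rw [gradedSign_apply k _ r hd, gradedSign_apply k _ r he,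
    gradedSign_apply k _ r (R.mul_mem hd he), mul_add, ε_add, smul_mul_smul_comm]

theorem d_mul (R : DGAlgebra k A) {x : A} (y : A) (hx : ∃ d, x ∈ R.gr d) :
    R.d (x * y) = R.d x * y + gradedSign k R.isInternal 1 x * R.d y := by
  obtain ⟨d, hd⟩ := hx
  rw [R.d_leibniz x y hd, gradedSign_apply k _ 1 hd, one_mul, smul_mul_assoc]

theorem gradedSign_gradedSign (R : DGAlgebra k A) (r s : ℤ) {x : A} (hx : ∃ d, x ∈ R.gr d) :
    gradedSign k R.isInternal r (gradedSign k R.isInternal s x) =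
      gradedSign k R.isInternal (r + s) x := by
  obtain ⟨d, hd⟩ := hx
  rw [gradedSign_apply k _ s hd, map_smul, gradedSign_apply k _ r hd,
    gradedSign_apply k _ (r + s) hd, smul_smul, add_mul, ε_add, mul_comm]

theorem d_gradedSign (R : DGAlgebra k A) (r : ℤ) {x : A} (hx : ∃ d, x ∈ R.gr d) :
    R.d (gradedSign k R.isInternal r x) =
      ε k r • gradedSign k R.isInternal r (R.d x) := by
  obtain ⟨d, hd⟩ := hx
  rw [gradedSign_apply k _ r hd, map_smul, gradedSign_apply k _ r (R.d_mem hd), smul_smul,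
    mul_add, ε_add, mul_one, mul_comm (ε k (r * d)), ← mul_assoc, ε_mul_self, one_mul]

end HomogeneousSequences

section HochschildDifferential

variable {k}

/-- The `i`-th coface of a function `F` of `p` variables, with sign twist of degree `r`. -/
def coface (St : DGBimod k R M) (p : ℕ) (r : ℤ) (i : ℕ) (F : (ℕ → A) → M) (a : ℕ → A) : M :=
  if i = 0 then St.actL (gradedSign k R.isInternal r (a 0)) (F fun j => a (j + 1))
  else if i ≤ p then F (mergeAt (i - 1) a)
  else St.actR (a p) (F a)

theorem coface_zero (St : DGBimod k R M) (p : ℕ) (r : ℤ) (F : (ℕ → A) → M) (a : ℕ → A) :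
    coface St p r 0 F a =
      St.actL (gradedSign k R.isInternal r (a 0)) (F fun j => a (j + 1)) := by
  simp [coface]

theorem coface_of_lt (St : DGBimod k R M) {p m : ℕ} (r : ℤ) (hm : m < p) (F : (ℕ → A) → M)
    (a : ℕ → A) : coface St p r (m + 1) F a = F (mergeAt m a) := by
  simp [coface, hm]

theorem coface_last (St : DGBimod k R M) (p : ℕ) (r : ℤ) (F : (ℕ → A) → M) (a : ℕ → A) :
    coface St p r (p + 1) F a = St.actR (a p) (F a) := by
  simp [coface]

/-- The function of sequences defined by a cochain. -/
def evalSeq {p : ℕ} (f : MCoch k A M p) (a : ℕ → A) : M := f fun i => a i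

theorem evalSeq_congr {p : ℕ} (f : MCoch k A M p) {a b : ℕ → A} (h : ∀ i < p, a i = b i) :
    evalSeq f a = evalSeq f b :=
  congrArg f (funext fun i => h i i.2)

theorem IsHochDiffM.evalSeq_eq {St : DGBimod k R M}
    {dHM : ∀ (p : ℕ) (r : ℤ), MCoch k A M p →ₗ[k] MCoch k A M (p + 1)}
    (hd : IsHochDiffM k St dHM) (p : ℕ) (r : ℤ) (f : MCoch k A M p) {a : ℕ → A}
    (ha : IsHomogSeq k R a) :
    evalSeq (dHM p r f) a = ε k (p + r - 1) •
      ∑ i ∈ Finset.range (p + 2), ε k i • coface St p r i (evalSeq f) a := by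
  choose dg hdg using ha
  rw [Finset.sum_range_succ, Finset.sum_range_succ', coface_last, coface_zero]
  have hmid : ∑ i ∈ Finset.range p, ε k (i + 1 : ℕ) • coface St p r (i + 1) (evalSeq f) a =
      ∑ i : Fin p, ε k (i + 1 : ℕ) • evalSeq f (mergeAt i a) := by
    rw [Finset.sum_range]
    exact Finset.sum_congr rfl fun i _ => by rw [coface_of_lt St r i.2]
  refine (hd p r f dg a hdg).trans ?_
  rw [hmid, gradedSign_apply k R.isInternal r (hdg 0), smul_add, smul_add,
    Finset.smul_sum, add_comm (∑ i, _)]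
  congr 1
  · congr 1
    · simp [ε_add, ε_zero, smul_smul, evalSeq]
    · refine Finset.sum_congr rfl fun i _ => ?_
      rw [smul_smul]
      congr 1
      push_cast
      simp only [ε_add, ε_sub, ε_one]
      ring
  · rw [smul_smul]
    congr 1
    push_cast
    simp only [ε_add, ε_sub, ε_one]
    linear_combination (-ε k r) * ε_mul_self k p

theorem coface_coface (St : DGBimod k R M) {p : ℕ} (r : ℤ) (f : MCoch k A M p) {i j : ℕ}
    (hij : i < j) (hj : j ≤ p + 2) {a : ℕ → A} (ha : IsHomogSeq k R a) :
    coface St (p + 1) r j (coface St p r i (evalSeq f)) a =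
      coface St (p + 1) r i (coface St p r (j - 1) (evalSeq f)) a := by
  obtain ⟨j, rfl⟩ : ∃ l, j = l + 1 := ⟨j - 1, by omega⟩
  simp only [Nat.add_sub_cancel]
  rcases Nat.eq_zero_or_pos i with rfl | hi
  · rcases Nat.eq_zero_or_pos j with rfl | hj0
    · rw [coface_of_lt _ _ (by omega), coface_zero, coface_zero, coface_zero]
      simp only [mergeAt]
      simp [gradedSign_mul R r (ha 0) (ha 1), St.actL_mul]
    · obtain ⟨j, rfl⟩ : ∃ l, j = l + 1 := ⟨j - 1, by omega⟩
      rw [coface_zero]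
      rcases Nat.lt_or_ge j p with hjp | hjp
      · rw [coface_of_lt _ _ (by omega), coface_zero, coface_of_lt _ _ hjp]
        congr 1
        refine evalSeq_congr f fun l _ => ?_
        simp [mergeAt]
      · obtain rfl : j = p := by omega
        rw [coface_last, coface_last, coface_zero, St.actLR]
  · obtain ⟨i, rfl⟩ : ∃ l, i = l + 1 := ⟨i - 1, by omega⟩
    rw [coface_of_lt _ _ (m := i) (by omega)]
    obtain ⟨j, rfl⟩ : ∃ l, j = l + 1 := ⟨j - 1, by omega⟩
    rcases Nat.lt_or_ge j p with hjp | hjp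
    · rw [coface_of_lt _ _ (by omega), coface_of_lt _ _ (by omega), coface_of_lt _ _ hjp]
      refine evalSeq_congr f fun l _ => ?_
      rcases Nat.lt_or_ge i j with hij' | hij'
      · simp only [mergeAt]
        split_ifs <;> first | rfl | omega
      · obtain rfl : i = j := by omega
        simp only [mergeAt]
        split_ifs <;> first | rfl | omega | (subst_vars; simp [mul_assoc])
    · obtain rfl : j = p := by omega
      rw [coface_last, coface_last]
      rcases Nat.lt_or_ge i j with hij' | hij'
      · rw [coface_of_lt _ _ hij']
        simp [mergeAt, show ¬ j < i by omega, show ¬ j = i by omega]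
      · obtain rfl : i = j := by omega
        rw [coface_last, ← St.actR_mul]
        simp only [mergeAt, lt_irrefl, if_true, if_false]
        congr 1
        exact evalSeq_congr f fun l hl => by simp [mergeAt, hl]

theorem coface_congr (St : DGBimod k R M) (p : ℕ) (r : ℤ) (i : ℕ) {F G : (ℕ → A) → M}
    (h : ∀ a, IsHomogSeq k R a → F a = G a) {a : ℕ → A} (ha : IsHomogSeq k R a) :
    coface St p r i F a = coface St p r i G a := by
  unfold coface
  rw [h _ ha, h _ ha.tail, h _ (ha.mergeAt _)]

theorem coface_smul_sum (St : DGBimod k R M) (p : ℕ) (r : ℤ) (i : ℕ) (c : k) (s : Finset ℕ)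
    (e : ℕ → k) (F : ℕ → (ℕ → A) → M) (a : ℕ → A) :
    coface St p r i (fun b => c • ∑ l ∈ s, e l • F l b) a =
      c • ∑ l ∈ s, e l • coface St p r i (F l) a := by
  unfold coface
  split_ifs <;> simp [map_sum]

/-- The alternating double sum of a family satisfying the cosimplicial identities vanishes. -/
theorem sum_sum_cosimplicial (n : ℕ) (G : ℕ → ℕ → M)
    (hG : ∀ i j, i < j → j ≤ n → G j i = G i (j - 1)) :
    ∑ j ∈ Finset.range (n + 1), ∑ i ∈ Finset.range n, (ε k j * ε k i) • G j i = 0 := by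
  rw [← Finset.sum_product']
  refine Finset.sum_involution
    (fun x _ => if x.2 < x.1 then (x.2, x.1 - 1) else (x.2 + 1, x.1)) ?_ ?_ ?_ ?_
  · rintro ⟨j, i⟩ hx
    simp only [Finset.mem_product, Finset.mem_range] at hx
    dsimp only
    split_ifs with h
    · obtain ⟨j, rfl⟩ : ∃ l, j = l + 1 := ⟨j - 1, by omega⟩
      dsimp only
      rw [hG i (j + 1) h (by omega), ← add_smul]
      simp [ε_add, ε_one, mul_comm]
    · dsimp only
      rw [hG j (i + 1) (by omega) (by omega), Nat.add_sub_cancel, ← add_smul]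
      simp [ε_add, ε_one, mul_comm]
  · rintro ⟨j, i⟩ hx _
    dsimp only
    split_ifs with h <;> simp only [ne_eq, Prod.mk.injEq] <;> omega
  · rintro ⟨j, i⟩ hx
    simp only [Finset.mem_product, Finset.mem_range] at hx
    dsimp only
    split_ifs with h <;> simp only [Finset.mem_product, Finset.mem_range] <;> omega
  · rintro ⟨j, i⟩ hx
    dsimp only
    by_cases h : i < j
    · simp only [if_pos h, if_neg (show ¬ j - 1 < i by omega)]
      exact Prod.ext (Nat.sub_add_cancel (by omega)) rfl
    · simp only [if_neg h, if_pos (show j < i + 1 by omega), Nat.add_sub_cancel]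

theorem IsHochDiffM.sq_eq_zero {St : DGBimod k R M}
    {dHM : ∀ (p : ℕ) (r : ℤ), MCoch k A M p →ₗ[k] MCoch k A M (p + 1)}
    (hd : IsHochDiffM k St dHM) (p : ℕ) (r : ℤ) (f : MCoch k A M p) :
    dHM (p + 1) r (dHM p r f) = 0 := by
  refine MCoch.ext_of_homogSeq R fun a ha => ?_
  change evalSeq _ a = 0
  rw [hd.evalSeq_eq _ _ _ ha]
  have h : ∀ j ∈ Finset.range (p + 1 + 2),
      ε k j • coface St (p + 1) r j (evalSeq (dHM p r f)) a =
      ε k (p + r - 1) • ∑ i ∈ Finset.range (p + 2), (ε k j * ε k i) •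
        coface St (p + 1) r j (coface St p r i (evalSeq f)) a := by
    intro j _
    rw [coface_congr St (p + 1) r j (fun b hb => hd.evalSeq_eq p r f hb) ha, coface_smul_sum,
      smul_comm, Finset.smul_sum]
    simp only [smul_smul]
  rw [Finset.sum_congr rfl h, ← Finset.smul_sum,
    sum_sum_cosimplicial (p + 2)
      (fun j i => coface St (p + 1) r j (coface St p r i (evalSeq f)) a)
      fun i j hij hj => coface_coface St r f hij hj ha, smul_zero, smul_zero]

end HochschildDifferential

section InternalDifferential

variable {k}

/-- The internal differential on cochains induced by `d_A` and `d_M`. -/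
def intDiff (St : DGBimod k R M) (p : ℕ) (r : ℤ) : MCoch k A M p →ₗ[k] MCoch k A M p where
  toFun f := St.dM.compMultilinearMap f - ε k r • ∑ i : Fin p, f.compLinearMap fun j =>
    if j < i then gradedSign k R.isInternal 1 else if j = i then R.d else LinearMap.id
  map_add' f g := by
    ext a
    simp [Finset.sum_add_distrib, smul_add]
    abel
  map_smul' c f := by
    ext a
    simp [Finset.smul_sum, smul_sub, smul_comm c]

theorem evalSeq_intDiff (St : DGBimod k R M) (p : ℕ) (r : ℤ) (f : MCoch k A M p) (a : ℕ → A) :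
    evalSeq (intDiff St p r f) a =
      St.dM (evalSeq f a) - ε k r • ∑ j ∈ Finset.range p, evalSeq f (diffAt R j a) := by
  rw [Finset.sum_range]
  simp only [evalSeq, intDiff, LinearMap.coe_mk, AddHom.coe_mk, sub_apply,
    LinearMap.compMultilinearMap_apply, smul_apply, sum_apply,
    MultilinearMap.compLinearMap_apply]
  congr 2
  refine Finset.sum_congr rfl fun i _ => congrArg f (funext fun j => ?_)
  simp only [diffAt, Fin.lt_def, Fin.ext_iff]
  split_ifs with h₁ h₂
  · rfl
  · rw [h₂]
  · rfl

/-- Scaling the entries of a homogeneous sequence by scalars. -/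
theorem evalSeq_smul {p : ℕ} (f : MCoch k A M p) (c : ℕ → k) (a : ℕ → A) :
    evalSeq f (fun i => c i • a i) = (∏ i : Fin p, c i) • evalSeq f a :=
  f.map_smul_univ (fun i : Fin p => c i) fun i => a i

theorem prod_ε {p : ℕ} (dg : ℕ → ℤ) : ∏ i : Fin p, ε k (dg i) = ε k (∑ i : Fin p, dg i) := by
  induction p with
  | zero => simp [ε_zero]
  | succ p ih => rw [Fin.prod_univ_castSucc, Fin.sum_univ_castSucc, ε_add]; simp [ih]

theorem evalSeq_diffAt {p j : ℕ} (hj : j < p) (f : MCoch k A M p) {dg : ℕ → ℤ} {a : ℕ → A}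
    (ha : ∀ i, a i ∈ R.gr (dg i)) :
    evalSeq f (diffAt R j a) = ε k (∑ l ∈ Finset.range j, dg l) •
      f (fun l => if (l : ℕ) = j then R.d (a j) else a l) := by
  have h : diffAt R j a = fun l => (if l < j then ε k (dg l) else 1) •
      (if l = j then R.d (a j) else a l) := by
    funext l
    unfold diffAt
    split_ifs with h₁ h₂ h₂
    · omega
    · rw [gradedSign_apply k _ _ (ha l), one_mul]
    · rw [one_smul]
    · rw [one_smul]
  have hfilter : (Finset.range p).filter (· < j) = Finset.range j := by
    ext l
    simp only [Finset.mem_filter, Finset.mem_range]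
    omega
  rw [h, evalSeq_smul f (fun l => if l < j then ε k (dg l) else 1)
    (fun l => if l = j then R.d (a j) else a l),
    ← Finset.prod_range (fun l => if l < j then ε k (dg l) else 1), Finset.prod_ite,
    Finset.prod_const_one, mul_one, hfilter, Finset.prod_range, prod_ε, ← Finset.sum_range]
  rfl

theorem intDiff_isIntDiffM (St : DGBimod k R M) : IsIntDiffM k St (intDiff St) := by
  intro p r f dg a ha
  refine (evalSeq_intDiff St p r f a).trans ?_
  rw [Finset.sum_range]
  congr 2
  exact Finset.sum_congr rfl fun i _ => evalSeq_diffAt i.2 f ha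

theorem evalSeq_add_of_eq {p m : ℕ} (hm : m < p) (f : MCoch k A M p) {a b c : ℕ → A}
    (h : ∀ i, i ≠ m → a i = c i ∧ b i = c i) (hc : c m = a m + b m) :
    evalSeq f c = evalSeq f a + evalSeq f b := by
  have hu : ∀ e : ℕ → A, (∀ i, i ≠ m → e i = c i) → (fun i : Fin p => e i) =
      Function.update (fun i : Fin p => c i) ⟨m, hm⟩ (e m) := by
    intro e he
    funext i
    by_cases hi : i = ⟨m, hm⟩
    · subst hi; simp
    · rw [Function.update_of_ne hi]
      exact he i fun hi' => hi (Fin.ext hi')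
  unfold evalSeq
  rw [hu a fun i hi => (h i hi).1, hu b fun i hi => (h i hi).2,
    ← MultilinearMap.map_update_add, ← hc, ← hu c fun _ _ => rfl]

theorem mergeAt_diffAt_of_lt (R : DGAlgebra k A) {m j : ℕ} (hj : j < m) (a : ℕ → A) :
    mergeAt m (diffAt R j a) = diffAt R j (mergeAt m a) := by
  funext l
  simp only [mergeAt, diffAt]
  split_ifs <;> first | rfl | omega

theorem mergeAt_diffAt_of_gt {R : DGAlgebra k A} {m j : ℕ} (hj : m < j) {a : ℕ → A}
    (ha : IsHomogSeq k R a) :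
    mergeAt m (diffAt R (j + 1) a) = diffAt R j (mergeAt m a) := by
  funext l
  simp only [mergeAt, diffAt]
  split_ifs <;> first | rfl | omega | exact (gradedSign_mul R 1 (ha _) (ha _)).symm

theorem evalSeq_diffAt_mergeAt {R : DGAlgebra k A} {p m : ℕ} (hm : m < p) (f : MCoch k A M p)
    {a : ℕ → A} (ha : IsHomogSeq k R a) :
    evalSeq f (diffAt R m (mergeAt m a)) =
      evalSeq f (mergeAt m (diffAt R m a)) + evalSeq f (mergeAt m (diffAt R (m + 1) a)) := by
  refine evalSeq_add_of_eq hm f (fun i hi => ?_) ?_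
  · simp only [mergeAt, diffAt]
    constructor <;> split_ifs <;> first | rfl | omega
  · simp [mergeAt, diffAt, d_mul R _ (ha m)]

theorem sum_evalSeq_mergeAt_diffAt {R : DGAlgebra k A} {p m : ℕ} (hm : m < p)
    (f : MCoch k A M p) {a : ℕ → A} (ha : IsHomogSeq k R a) :
    ∑ j ∈ Finset.range (p + 1), evalSeq f (mergeAt m (diffAt R j a)) =
      ∑ j ∈ Finset.range p, evalSeq f (diffAt R j (mergeAt m a)) := by
  obtain ⟨q, rfl⟩ : ∃ q, p = m + 1 + q := ⟨p - (m + 1), by omega⟩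
  rw [show m + 1 + q + 1 = m + 2 + q by omega, Finset.sum_range_add, Finset.sum_range_add _ (m + 1),
    Finset.sum_range_succ, Finset.sum_range_succ, Finset.sum_range_succ,
    evalSeq_diffAt_mergeAt hm f ha, add_assoc (∑ j ∈ Finset.range m, _)]
  congr 1
  · congr 1
    exact Finset.sum_congr rfl fun j hj => by
      rw [mergeAt_diffAt_of_lt R (Finset.mem_range.mp hj)]
  · exact Finset.sum_congr rfl fun j hj => by
      rw [show m + 2 + j = m + 1 + j + 1 by omega, mergeAt_diffAt_of_gt (by omega) ha]

theorem diffAt_succ_tail (R : DGAlgebra k A) (j : ℕ) (a : ℕ → A) :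
    (fun l => diffAt R (j + 1) a (l + 1)) = diffAt R j fun l => a (l + 1) := by
  funext l
  simp [diffAt]

/-- Each coface intertwines the internal differentials. -/
theorem coface_intDiff {St : DGBimod k R M} {p : ℕ} {r : ℤ} {f : MCoch k A M p}
    (hf : IsHomogM k St p r f) {i : ℕ} (hi : i ≤ p + 1) {a : ℕ → A} (ha : IsHomogSeq k R a) :
    coface St p (r + 1) i (evalSeq (intDiff St p r f)) a =
      St.dM (coface St p r i (evalSeq f) a) -
        ε k r • ∑ j ∈ Finset.range (p + 1), coface St p r i (evalSeq f) (diffAt R j a) := by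
  rcases Nat.eq_zero_or_pos i with rfl | hi0
  · simp only [coface_zero, evalSeq_intDiff]
    obtain ⟨d, hd⟩ := exists_gradedSign_mem R r (ha 0)
    have hσ : gradedSign k R.isInternal (r + 1) (a 0) =
        ε k d • gradedSign k R.isInternal r (a 0) := by
      rw [add_comm, ← gradedSign_gradedSign R 1 r (ha 0), gradedSign_apply k _ 1 hd, one_mul]
    have htail : ∀ j, St.actL (gradedSign k R.isInternal r (diffAt R (j + 1) a 0))
        (evalSeq f fun l => diffAt R (j + 1) a (l + 1)) =
        St.actL (gradedSign k R.isInternal (r + 1) (a 0))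
          (evalSeq f (diffAt R j fun l => a (l + 1))) := by
      intro j
      rw [diffAt_succ_tail, ← gradedSign_gradedSign R r 1 (ha 0)]
      simp [diffAt]
    have hhead : St.actL (gradedSign k R.isInternal r (diffAt R 0 a 0))
        (evalSeq f fun l => diffAt R 0 a (l + 1)) =
        St.actL (gradedSign k R.isInternal r (R.d (a 0))) (evalSeq f fun l => a (l + 1)) := by
      simp [diffAt]
    rw [Finset.sum_range_succ', hhead, Finset.sum_congr rfl fun j _ => htail j,
      St.dM_actL _ _ hd, d_gradedSign R r (ha 0), hσ]
    simp only [map_sub, map_smul, map_sum, LinearMap.smul_apply, smul_add]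
    abel
  · obtain ⟨m, rfl⟩ : ∃ m, i = m + 1 := ⟨i - 1, by omega⟩
    rcases Nat.lt_or_ge m p with hm | hm
    · simp only [coface_of_lt St _ hm, evalSeq_intDiff, sum_evalSeq_mergeAt_diffAt hm f ha]
    · obtain rfl : m = p := by omega
      simp only [coface_last, evalSeq_intDiff]
      choose dg hdg using ha
      have hfa : evalSeq f a ∈ St.gr ((∑ i : Fin m, dg i) + r) := hf dg a hdg
      have hlast : evalSeq f (diffAt R m a) = ε k (∑ i : Fin m, dg i) • evalSeq f a := by
        rw [← prod_ε, ← evalSeq_smul f (fun i => ε k (dg i))]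
        refine evalSeq_congr f fun i hi => ?_
        simp [diffAt, hi, gradedSign_apply k R.isInternal 1 (hdg i)]
      have hcoef : ∀ j ∈ Finset.range m, St.actR (diffAt R j a m) (evalSeq f (diffAt R j a)) =
          St.actR (a m) (evalSeq f (diffAt R j a)) := by
        intro j hj
        have := Finset.mem_range.mp hj
        simp [diffAt, show ¬ m < j by omega, show ¬ m = j by omega]
      have hd : diffAt R m a m = R.d (a m) := by simp [diffAt]
      rw [Finset.sum_range_succ, Finset.sum_congr rfl hcoef, hlast, hd, St.dM_actR _ _ hfa, ε_add,
        mul_comm (ε k _), mul_smul]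
      simp only [map_sub, map_smul, map_sum, smul_add]
      abel

theorem IsHochDiffM.intDiff_add {St : DGBimod k R M}
    {dHM : ∀ (p : ℕ) (r : ℤ), MCoch k A M p →ₗ[k] MCoch k A M (p + 1)}
    (hd : IsHochDiffM k St dHM) {p : ℕ} {r : ℤ} {f : MCoch k A M p}
    (hf : IsHomogM k St p r f) :
    intDiff St (p + 1) r (dHM p r f) + dHM p (r + 1) (intDiff St p r f) = 0 := by
  refine MCoch.ext_of_homogSeq R fun a ha => ?_
  change evalSeq (intDiff St (p + 1) r (dHM p r f)) a +
    evalSeq (dHM p (r + 1) (intDiff St p r f)) a = 0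
  have hinner : ∑ j ∈ Finset.range (p + 1), evalSeq (dHM p r f) (diffAt R j a) =
      ε k (p + r - 1) • ∑ i ∈ Finset.range (p + 2), ε k i •
        ∑ j ∈ Finset.range (p + 1), coface St p r i (evalSeq f) (diffAt R j a) := by
    simp only [fun j => hd.evalSeq_eq p r f (ha.diffAt j), Finset.smul_sum]
    exact Finset.sum_comm
  have hcoface : ∑ i ∈ Finset.range (p + 2),
      ε k i • coface St p (r + 1) i (evalSeq (intDiff St p r f)) a =
      St.dM (∑ i ∈ Finset.range (p + 2), ε k i • coface St p r i (evalSeq f) a) -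
        ε k r • ∑ i ∈ Finset.range (p + 2), ε k i •
          ∑ j ∈ Finset.range (p + 1), coface St p r i (evalSeq f) (diffAt R j a) := by
    rw [map_sum, Finset.smul_sum, ← Finset.sum_sub_distrib]
    refine Finset.sum_congr rfl fun i hi => ?_
    rw [coface_intDiff hf (by have := Finset.mem_range.mp hi; omega) ha, smul_sub, map_smul,
      smul_comm (ε k r)]
  have hε : ε k (p + (r + 1) - 1) = - ε k (p + r - 1) := by
    simp [ε_add, ε_sub, ε_one]
  rw [evalSeq_intDiff, hd.evalSeq_eq _ _ _ ha, hd.evalSeq_eq _ _ _ ha, hinner, hcoface, hε,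
    map_smul, neg_smul, smul_sub, smul_comm (ε k r)]
  abel

end InternalDifferential

section Acyclicity

variable {k}

theorem sum_mergeAt_degree {p m : ℕ} (hm : m < p) (dg : ℕ → ℤ) :
    ∑ l : Fin p, (if (l : ℕ) < m then dg l else if (l : ℕ) = m then dg m + dg (m + 1)
      else dg (l + 1)) = ∑ l : Fin (p + 1), dg l := by
  obtain ⟨q, rfl⟩ : ∃ q, p = m + 1 + q := ⟨p - (m + 1), by omega⟩
  rw [← Finset.sum_range (fun l => if l < m then dg l else if l = m then dg m + dg (m + 1)
      else dg (l + 1)), ← Finset.sum_range, show m + 1 + q + 1 = m + 2 + q by omega,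
    Finset.sum_range_add, Finset.sum_range_add _ (m + 2), Finset.sum_range_succ,
    Finset.sum_range_succ _ (m + 1), Finset.sum_range_succ _ m]
  simp only [lt_irrefl, if_true, if_false, add_assoc]
  congr 1
  · exact Finset.sum_congr rfl fun l hl => if_pos (Finset.mem_range.mp hl)
  · congr 2
    refine Finset.sum_congr rfl fun l _ => ?_
    rw [if_neg (by omega), if_neg (by omega)]
    congr 1
    omega

theorem IsHochDiffM.isHomogM {St : DGBimod k R M}
    {dHM : ∀ (p : ℕ) (r : ℤ), MCoch k A M p →ₗ[k] MCoch k A M (p + 1)}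
    (hd : IsHochDiffM k St dHM) {p : ℕ} {r : ℤ} (s : ℤ) {f : MCoch k A M p}
    (hf : IsHomogM k St p r f) : IsHomogM k St (p + 1) r (dHM p s f) := by
  intro dg a ha
  rw [hd p s f dg a ha]
  refine add_mem (add_mem ?_ (sum_mem fun i _ => ?_)) ?_ <;> refine Submodule.smul_mem _ _ ?_
  · rw [Fin.sum_univ_succ, add_assoc]
    exact St.actL_mem (ha 0) (hf (fun i => dg (i + 1)) (fun i => a (i + 1)) fun i => ha _)
  · have := hf (fun l => if l < i then dg l else if l = i then dg i + dg (i + 1) else dg (l + 1))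
      (mergeAt i a) (fun l => by
        unfold mergeAt
        split_ifs
        · exact ha l
        · exact R.mul_mem (ha _) (ha _)
        · exact ha _)
    rw [sum_mergeAt_degree i.2] at this
    exact this
  · rw [Fin.sum_univ_castSucc, add_right_comm]
    exact St.actR_mem (ha p) (hf dg a ha)

theorem IsContracting.isHomogM_Hop {St : DGBimod k R M} {h : M →ₗ[k] M}
    (hh : IsContracting k St h) {p : ℕ} {r : ℤ} {f : MCoch k A M p}
    (hf : IsHomogM k St p r f) : IsHomogM k St p (r - 1) (Hop k h f) := fun dg a ha => by
  rw [← add_sub_assoc]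
  exact hh.2 (hf dg a ha)

theorem IsContracting.intDiff_Hop {St : DGBimod k R M} {h : M →ₗ[k] M}
    (hh : IsContracting k St h) (p : ℕ) (r : ℤ) (f : MCoch k A M p) :
    intDiff St p (r - 1) (Hop k h f) + Hop k h (intDiff St p r f) = f := by
  refine MCoch.ext_of_homogSeq R fun a _ => ?_
  change evalSeq (intDiff St p (r - 1) (Hop k h f)) a + h (evalSeq (intDiff St p r f) a) =
    evalSeq f a
  have hH : ∀ b, evalSeq (Hop k h f) b = h (evalSeq f b) := fun _ => rfl
  simp only [evalSeq_intDiff, hH, map_sub, map_smul, map_sum, ε_sub, ε_one]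
  rw [mul_neg_one, neg_smul]
  refine Eq.trans ?_ (hh.1 (evalSeq f a))
  abel

/-- The solution `g` of the recursion `g = c - d_H (h ∘ g)`. -/
def correctedCochain (dHM : ∀ (p : ℕ) (r : ℤ), MCoch k A M p →ₗ[k] MCoch k A M (p + 1))
    (h : M →ₗ[k] M) (n : ℤ) (c : TotMCoch k A M) : (q : ℕ) → MCoch k A M q
  | 0 => c 0
  | q + 1 => c (q + 1) - dHM q (n - 1 - q) (Hop k h (correctedCochain dHM h n c q))

section

variable {St : DGBimod k R M}
  {dHM : ∀ (p : ℕ) (r : ℤ), MCoch k A M p →ₗ[k] MCoch k A M (p + 1)}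
  {h : M →ₗ[k] M} {n : ℤ} {c : TotMCoch k A M}

theorem correctedCochain_isHomogM (hd : IsHochDiffM k St dHM) (hh : IsContracting k St h)
    (hc : TotHomogM k St n c) (q : ℕ) :
    IsHomogM k St q (n - q) (correctedCochain dHM h n c q) := by
  induction q with
  | zero => exact hc 0
  | succ q ih =>
    intro dg a ha
    refine sub_mem (hc (q + 1) dg a ha) ?_
    have := hd.isHomogM (n - 1 - q) (hh.isHomogM_Hop ih) dg a ha
    convert this using 2
    push_cast
    ring

theorem intDiff_correctedCochain (hd : IsHochDiffM k St dHM) (hh : IsContracting k St h)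
    (hc : TotHomogM k St n c) (hcoc : TotIsCocycleM k dHM (intDiff St) n c) (q : ℕ) :
    intDiff St q (n - q) (correctedCochain dHM h n c q) = 0 := by
  induction q with
  | zero => simpa [TotDM, correctedCochain] using hcoc 0
  | succ q ih =>
    have hanti := hd.intDiff_add (hh.isHomogM_Hop (correctedCochain_isHomogM hd hh hc q))
    have hhop := hh.intDiff_Hop q (n - q) (correctedCochain dHM h n c q)
    have hzero : Hop k h (0 : MCoch k A M q) = 0 := by ext; simp [Hop]
    rw [ih, hzero, add_zero] at hhop
    rw [hhop, sub_add_cancel] at hanti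
    have hcq : dHM q (n - q) (correctedCochain dHM h n c q) = dHM q (n - q) (c q) := by
      cases q with
      | zero => rfl
      | succ q =>
        rw [correctedCochain, map_sub]
        rw [show n - 1 - (q : ℤ) = n - (q + 1 : ℕ) by push_cast; ring, hd.sq_eq_zero, sub_zero]
    have hc' : intDiff St (q + 1) (n - ((q : ℤ) + 1)) (c (q + 1)) + dHM q (n - q) (c q) = 0 :=
      hcoc (q + 1)
    rw [hcq] at hanti
    rw [correctedCochain, map_sub, show n - 1 - (q : ℤ) = n - q - 1 by ring,
      show n - ((q + 1 : ℕ) : ℤ) = n - q - 1 by push_cast; ring]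
    rw [show n - ((q : ℤ) + 1) = n - q - 1 by ring] at hc'
    rw [sub_eq_zero, eq_neg_of_add_eq_zero_left hc', eq_neg_of_add_eq_zero_left hanti]

theorem Hop_correctedCochain_add {P : ℕ} (hP : ∀ q ≥ P, c q = 0) (j : ℕ) :
    Hop k h (correctedCochain dHM h n c (P + j)) =
      (-1 : k) ^ j • frakh k dHM h P (n - P) j (correctedCochain dHM h n c P) := by
  have hsmul : ∀ {p : ℕ} (x : k) (f : MCoch k A M p), Hop k h (x • f) = x • Hop k h f :=
    fun x f => by ext; simp [Hop]
  induction j with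
  | zero => simp [frakh]
  | succ j ih =>
    change Hop k h (c (P + j + 1) - dHM (P + j) (n - 1 - (P + j : ℕ))
        (Hop k h (correctedCochain dHM h n c (P + j)))) =
      _ • Hop k h (dHM (P + j) (n - P - j - 1)
        (frakh k dHM h P (n - P) j (correctedCochain dHM h n c P)))
    rw [ih, hP _ (by omega), zero_sub, map_smul, pow_succ, mul_neg_one, neg_smul, ← hsmul,
      ← neg_one_smul k, hsmul, neg_one_smul,
      show n - 1 - ((P + j : ℕ) : ℤ) = n - P - j - 1 by push_cast; ring]

/-- The sum Hochschild complex of a pointwisely nilpotent dg bimodule is acyclic. -/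
theorem PointwiseNilpotent.totIsCoboundaryM (hpn : PointwiseNilpotent k St dHM)
    (hd : IsHochDiffM k St dHM) (hc : TotHomogM k St n c) (hfin : TotFinSuppM k c)
    (hcoc : TotIsCocycleM k dHM (intDiff St) n c) :
    TotIsCoboundaryM k St dHM (intDiff St) n c := by
  obtain ⟨h, hh, hnil⟩ := hpn
  obtain ⟨P, hP⟩ := hfin
  have hg := correctedCochain_isHomogM hd hh hc
  have hhop : ∀ q : ℕ, intDiff St q (n - q - 1) (Hop k h (correctedCochain dHM h n c q)) =
      correctedCochain dHM h n c q := by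
    intro q
    have := hh.intDiff_Hop q (n - q) (correctedCochain dHM h n c q)
    rw [intDiff_correctedCochain hd hh hc hcoc q] at this
    rwa [show Hop k h (0 : MCoch k A M q) = 0 by ext; simp [Hop], add_zero] at this
  refine ⟨fun q => Hop k h (correctedCochain dHM h n c q), fun q => ?_, ?_, fun q => ?_⟩
  · rw [show n - 1 - (q : ℤ) = n - q - 1 by ring]
    exact hh.isHomogM_Hop (hg q)
  · obtain ⟨J, hJ⟩ := hnil P (n - P) _ (hg P)
    refine ⟨P + (J + 1), fun q hq => ?_⟩
    obtain ⟨j, rfl⟩ : ∃ j, q = P + j := ⟨q - P, by omega⟩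
    dsimp only
    rw [Hop_correctedCochain_add hP, hJ j (by omega), smul_zero]
  · cases q with
    | zero => simpa [TotDM, correctedCochain] using (hhop 0).symm
    | succ q =>
      have := hhop (q + 1)
      rw [show n - ((q + 1 : ℕ) : ℤ) - 1 = n - 1 - ((q : ℤ) + 1) by push_cast; ring] at this
      simp only [TotDM]
      rw [this, correctedCochain, sub_add_cancel]

end

end Acyclicity

section Functoriality

variable {k}
variable {St : DGBimod k R M} {St' : DGBimod k R N}
  {dHM : ∀ (p : ℕ) (r : ℤ), MCoch k A M p →ₗ[k] MCoch k A M (p + 1)}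
  {pdM : ∀ (p : ℕ) (r : ℤ), MCoch k A M p →ₗ[k] MCoch k A M p}
  {dHN : ∀ (p : ℕ) (r : ℤ), MCoch k A N p →ₗ[k] MCoch k A N (p + 1)}
  {pdN : ∀ (p : ℕ) (r : ℤ), MCoch k A N p →ₗ[k] MCoch k A N p}

/-- Compatibility of the Hochschild differential with a linear map of degree `-s`. -/
theorem hochDiff_comp (hdM : IsHochDiffM k St dHM) (hdN : IsHochDiffM k St' dHN)
    (θ : M →ₗ[k] N) (s : ℤ)
    (hL : ∀ (i : ℤ) (a : A) (m : M), a ∈ R.gr i →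
      St'.actL a (θ m) = ε k (s * i) • θ (St.actL a m))
    (hR : ∀ (a : A) (m : M), St'.actR a (θ m) = θ (St.actR a m))
    (p : ℕ) (r : ℤ) (f : MCoch k A M p) :
    dHN p r (θ.compMultilinearMap f) = ε k s • θ.compMultilinearMap (dHM p (r + s) f) := by
  refine MCoch.ext_of_homogSeq R fun a ha => ?_
  choose dg hdg using ha
  rw [hdN p r _ dg a hdg, smul_apply]
  simp only [LinearMap.compMultilinearMap_apply]
  rw [hdM p _ f dg a hdg]
  simp only [map_add, map_sum, map_smul, smul_add,
    Finset.smul_sum, smul_smul, hL _ _ _ (hdg 0), hR]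
  congr 1
  · congr 1
    · congr 1
      simp only [ε_add, ε_sub, add_mul]
      linear_combination (-(ε k p * ε k r * ε k 1 * ε k (r * dg 0) * ε k (s * dg 0))) * ε_mul_self k s
    · refine Finset.sum_congr rfl fun i _ => ?_
      congr 1
      simp only [ε_add]
      linear_combination (-(ε k p * ε k r * ε k (i : ℕ))) * ε_mul_self k s
  · congr 1
    rw [ε_add]
    linear_combination (-(ε k r)) * ε_mul_self k s

/-- Compatibility of the internal differential with a linear map of degree `-s` which commutes
with the differentials up to the linear map `ξ`. -/
theorem intDiff_comp (hpM : IsIntDiffM k St pdM) (hpN : IsIntDiffM k St' pdN)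
    (θ ξ : M →ₗ[k] N) (s : ℤ) (hθ : ∀ m, St'.dM (θ m) = ε k s • θ (St.dM m) + ξ m)
    (p : ℕ) (r : ℤ) (f : MCoch k A M p) :
    pdN p r (θ.compMultilinearMap f) =
      ε k s • θ.compMultilinearMap (pdM p (r + s) f) + ξ.compMultilinearMap f := by
  refine MCoch.ext_of_homogSeq R fun a ha => ?_
  choose dg hdg using ha
  rw [hpN p r _ dg a hdg, add_apply, smul_apply]
  simp only [LinearMap.compMultilinearMap_apply]
  rw [hpM p _ f dg a hdg]
  simp only [map_sub, map_sum, map_smul, smul_sub, hθ]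
  rw [smul_smul (ε k s) (ε k (r + s)), ε_add, mul_comm (ε k r), ← mul_assoc, ε_mul_self, one_mul]
  abel

theorem totDM_comp (hdM : IsHochDiffM k St dHM) (hdN : IsHochDiffM k St' dHN)
    (hpM : IsIntDiffM k St pdM) (hpN : IsIntDiffM k St' pdN)
    (θ ξ : M →ₗ[k] N) (s : ℤ)
    (hL : ∀ (i : ℤ) (a : A) (m : M), a ∈ R.gr i →
      St'.actL a (θ m) = ε k (s * i) • θ (St.actL a m))
    (hR : ∀ (a : A) (m : M), St'.actR a (θ m) = θ (St.actR a m))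
    (hθ : ∀ m, St'.dM (θ m) = ε k s • θ (St.dM m) + ξ m)
    {n n' : ℤ} (hn : n' = n + s) (c : TotMCoch k A M) (p : ℕ) :
    TotDM k dHN pdN n (fun q => θ.compMultilinearMap (c q)) p =
      ε k s • θ.compMultilinearMap (TotDM k dHM pdM n' c p) + ξ.compMultilinearMap (c p) := by
  subst hn
  cases p with
  | zero => exact intDiff_comp hpM hpN θ ξ s hθ 0 n (c 0)
  | succ q =>
    simp only [TotDM]
    rw [intDiff_comp hpM hpN θ ξ s hθ, hochDiff_comp hdM hdN θ s hL hR,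
      show n - ((q : ℤ) + 1) + s = n + s - (q + 1) by ring,
      show n - (q : ℤ) + s = n + s - q by ring]
    ext a
    simp only [add_apply, smul_apply, LinearMap.compMultilinearMap_apply, map_add, smul_add]
    abel

theorem IsBimodHom.totDM_comp {φ : M →ₗ[k] N} (hφ : IsBimodHom k St St' φ)
    (hdM : IsHochDiffM k St dHM) (hdN : IsHochDiffM k St' dHN)
    (hpM : IsIntDiffM k St pdM) (hpN : IsIntDiffM k St' pdN)
    (n : ℤ) (c : TotMCoch k A M) (p : ℕ) :
    TotDM k dHN pdN n (fun q => φ.compMultilinearMap (c q)) p =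
      φ.compMultilinearMap (TotDM k dHM pdM n c p) := by
  obtain ⟨-, hd, hL, hR⟩ := hφ
  rw [KD.totDM_comp hdM hdN hpM hpN φ 0 0 (fun i a m _ => by simp [hL, ε_zero])
    (fun a m => (hR a m).symm) (fun m => by simp [hd, ε_zero]) (add_zero n).symm]
  ext a
  simp [ε_zero]

theorem totDM_add (n : ℤ) (c c' : TotMCoch k A M) (p : ℕ) :
    TotDM k dHM pdM n (fun q => c q + c' q) p =
      TotDM k dHM pdM n c p + TotDM k dHM pdM n c' p := by
  cases p with
  | zero => exact map_add _ _ _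
  | succ q => simp only [TotDM, map_add]; abel

theorem totDM_neg (n : ℤ) (c : TotMCoch k A M) (p : ℕ) :
    TotDM k dHM pdM n (fun q => -c q) p = -TotDM k dHM pdM n c p := by
  cases p with
  | zero => exact map_neg _ _
  | succ q => simp only [TotDM, map_neg]; abel

theorem totDM_zero (n : ℤ) (p : ℕ) : TotDM k dHM pdM n (fun _ => 0) p = 0 := by
  cases p with
  | zero => exact map_zero _
  | succ q => simp [TotDM]

theorem TotHomogM.comp {n n' s : ℤ} {θ : M →ₗ[k] N} {c : TotMCoch k A M}
    (hc : TotHomogM k St n' c) (hθ : ∀ i m, m ∈ St.gr (i + s) → θ m ∈ St'.gr i)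
    (hn : n' = n + s) : TotHomogM k St' n fun q => θ.compMultilinearMap (c q) := by
  intro p dg a ha
  refine hθ _ _ ?_
  have := hc p dg a ha
  rwa [hn, show (∑ i : Fin p, dg i) + (n + s - p) = (∑ i : Fin p, dg i) + (n - p) + s by ring]
    at this

theorem TotHomogM.add {n : ℤ} {c c' : TotMCoch k A M} (hc : TotHomogM k St n c)
    (hc' : TotHomogM k St n c') : TotHomogM k St n fun q => c q + c' q :=
  fun p dg a ha => add_mem (hc p dg a ha) (hc' p dg a ha)

theorem TotHomogM.neg {n : ℤ} {c : TotMCoch k A M} (hc : TotHomogM k St n c) :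
    TotHomogM k St n fun q => -c q :=
  fun p dg a ha => neg_mem (hc p dg a ha)

theorem TotFinSuppM.comp {θ : M →ₗ[k] N} {c : TotMCoch k A M} (hc : TotFinSuppM k c) :
    TotFinSuppM k fun q => θ.compMultilinearMap (c q) := by
  obtain ⟨P, hP⟩ := hc
  exact ⟨P, fun p hp => by ext; simp [hP p hp]⟩

theorem TotFinSuppM.add {c c' : TotMCoch k A M} (hc : TotFinSuppM k c)
    (hc' : TotFinSuppM k c') : TotFinSuppM k fun q => c q + c' q := by
  obtain ⟨P, hP⟩ := hc
  obtain ⟨Q, hQ⟩ := hc'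
  exact ⟨max P Q, fun p hp => by
    simp [hP p (le_trans (le_max_left _ _) hp), hQ p (le_trans (le_max_right _ _) hp)]⟩

theorem TotFinSuppM.neg {c : TotMCoch k A M} (hc : TotFinSuppM k c) :
    TotFinSuppM k fun q => -c q := by
  obtain ⟨P, hP⟩ := hc
  exact ⟨P, fun p hp => by simp [hP p hp]⟩

end Functoriality

section QuasiIso

variable {k}

/-- Post-composition with `φ` is a quasi-isomorphism of sum Hochschild complexes. -/
def InducesQuasiIso (StM : DGBimod k R M) (StN : DGBimod k R N)
    (dHM : ∀ (p : ℕ) (r : ℤ), MCoch k A M p →ₗ[k] MCoch k A M (p + 1))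
    (pdM : ∀ (p : ℕ) (r : ℤ), MCoch k A M p →ₗ[k] MCoch k A M p)
    (dHN : ∀ (p : ℕ) (r : ℤ), MCoch k A N p →ₗ[k] MCoch k A N (p + 1))
    (pdN : ∀ (p : ℕ) (r : ℤ), MCoch k A N p →ₗ[k] MCoch k A N p)
    (φ : M →ₗ[k] N) : Prop :=
  (∀ (n : ℤ) (c : TotMCoch k A N),
    TotHomogM k StN n c → TotFinSuppM k c → TotIsCocycleM k dHN pdN n c →
    ∃ b : TotMCoch k A M,
      TotHomogM k StM n b ∧ TotFinSuppM k b ∧ TotIsCocycleM k dHM pdM n b ∧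
      TotIsCoboundaryM k StN dHN pdN n (fun p => φ.compMultilinearMap (b p) - c p))
  ∧ (∀ (n : ℤ) (b : TotMCoch k A M),
    TotHomogM k StM n b → TotFinSuppM k b → TotIsCocycleM k dHM pdM n b →
    TotIsCoboundaryM k StN dHN pdN n (fun p => φ.compMultilinearMap (b p)) →
    TotIsCoboundaryM k StM dHM pdM n b)

variable {StM : DGBimod k R M} {StN : DGBimod k R N}
  {dHM : ∀ (p : ℕ) (r : ℤ), MCoch k A M p →ₗ[k] MCoch k A M (p + 1)}
  {pdM : ∀ (p : ℕ) (r : ℤ), MCoch k A M p →ₗ[k] MCoch k A M p}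
  {dHN : ∀ (p : ℕ) (r : ℤ), MCoch k A N p →ₗ[k] MCoch k A N (p + 1)}
  {pdN : ∀ (p : ℕ) (r : ℤ), MCoch k A N p →ₗ[k] MCoch k A N p}
  {φ : M →ₗ[k] N}

theorem IsBimodHom.totHomogM_comp (hφ : IsBimodHom k StM StN φ) {n : ℤ} {c : TotMCoch k A M}
    (hc : TotHomogM k StM n c) : TotHomogM k StN n fun q => φ.compMultilinearMap (c q) :=
  hc.comp (s := 0) (fun i m hm => hφ.1 i m (by simpa using hm)) (by simp)

theorem IsBimodHom.totIsCocycleM_comp (hφ : IsBimodHom k StM StN φ)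
    (hdM : IsHochDiffM k StM dHM) (hdN : IsHochDiffM k StN dHN)
    (hpM : IsIntDiffM k StM pdM) (hpN : IsIntDiffM k StN pdN)
    {n : ℤ} {c : TotMCoch k A M} (hc : TotIsCocycleM k dHM pdM n c) :
    TotIsCocycleM k dHN pdN n fun q => φ.compMultilinearMap (c q) := fun p => by
  rw [hφ.totDM_comp hdM hdN hpM hpN, hc p]
  ext
  simp

section Cone

variable {C : Type} [AddCommGroup C] [Module k C] {SC : DGBimod k R C}
  {inM : M →ₗ[k] C} {inN : N →ₗ[k] C}

/-- The underlying graded module of a mapping cone splits. -/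
theorem IsConeModel.exists_proj (hC : IsConeModel k StM StN φ SC inM inN) :
    ∃ (πM : C →ₗ[k] M) (πN : C →ₗ[k] N), (∀ c, inM (πM c) + inN (πN c) = c) ∧
      (∀ i c, c ∈ SC.gr i → πM c ∈ StM.gr (i + 1)) ∧
      (∀ i c, c ∈ SC.gr i → πN c ∈ StN.gr i) := by
  obtain ⟨hbij, -, -, -, -, hgr, -⟩ := hC
  let e : (M × N) ≃ₗ[k] C := LinearEquiv.ofBijective (inM.coprod inN) hbij
  have he : ∀ m n, e.symm (inM m + inN n) = (m, n) := fun m n =>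
    e.symm_apply_apply (m, n)
  refine ⟨LinearMap.fst k M N ∘ₗ e.symm, LinearMap.snd k M N ∘ₗ e.symm,
    fun c => e.apply_symm_apply c, fun i c hc => ?_, fun i c hc => ?_⟩
  all_goals
    obtain ⟨m, hm, n, hn, rfl⟩ := hgr i c hc
    simpa [he]

theorem IsConeModel.injective (hC : IsConeModel k StM StN φ SC inM inN) {p : ℕ}
    {x x' : MCoch k A M p} {y y' : MCoch k A N p}
    (h : inM.compMultilinearMap x + inN.compMultilinearMap y =
      inM.compMultilinearMap x' + inN.compMultilinearMap y') : x = x' ∧ y = y' := by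
  have key : ∀ a, (x a, y a) = (x' a, y' a) := fun a =>
    hC.1.1 (by simpa using congrArg (fun f => f a) h)
  exact ⟨MultilinearMap.ext fun a => congrArg Prod.fst (key a),
    MultilinearMap.ext fun a => congrArg Prod.snd (key a)⟩

theorem IsConeModel.totHomogM (hC : IsConeModel k StM StN φ SC inM inN) {n n' : ℤ}
    (hn : n' = n + 1) {x : TotMCoch k A M} {y : TotMCoch k A N} (hx : TotHomogM k StM n' x)
    (hy : TotHomogM k StN n y) :
    TotHomogM k SC n
      (fun q => inM.compMultilinearMap (x q) + inN.compMultilinearMap (y q)) := by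
  obtain ⟨-, -, -, hM, hN, -⟩ := hC
  exact (hx.comp hM hn).add
    (hy.comp (s := 0) (fun i m hm => hN i m (by simpa using hm)) (by simp))

/-- The total differential of the sum Hochschild complex of a mapping cone. -/
theorem IsConeModel.totDM (hC : IsConeModel k StM StN φ SC inM inN)
    {dHC : ∀ (p : ℕ) (r : ℤ), MCoch k A C p →ₗ[k] MCoch k A C (p + 1)}
    {pdC : ∀ (p : ℕ) (r : ℤ), MCoch k A C p →ₗ[k] MCoch k A C p}
    (hdM : IsHochDiffM k StM dHM) (hdN : IsHochDiffM k StN dHN)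
    (hpM : IsIntDiffM k StM pdM) (hpN : IsIntDiffM k StN pdN)
    (hdC : IsHochDiffM k SC dHC) (hpC : IsIntDiffM k SC pdC)
    {n n' : ℤ} (hn : n' = n + 1) (x : TotMCoch k A M) (y : TotMCoch k A N) (p : ℕ) :
    TotDM k dHC pdC n
        (fun q => inM.compMultilinearMap (x q) + inN.compMultilinearMap (y q)) p =
      inM.compMultilinearMap (-TotDM k dHM pdM n' x p) +
        inN.compMultilinearMap (φ.compMultilinearMap (x p) + TotDM k dHN pdN n y p) := by
  obtain ⟨-, hdm, hdn, -, -, -, hLM, hLN, hRM, hRN⟩ := hC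
  rw [totDM_add,
    totDM_comp hdM hdC hpM hpC inM (inN ∘ₗ φ) 1 (fun i a m ha => by rw [hLM i a m ha, one_mul])
      hRM (fun m => by simp [hdm, ε_one]) hn,
    totDM_comp hdN hdC hpN hpC inN 0 0 (fun i a m _ => by simp [hLN, ε_zero])
      hRN (fun m => by simp [hdn, ε_zero]) (add_zero n).symm]
  ext a
  simp [ε_one, ε_zero, add_assoc]

end Cone

theorem ConePN.inducesQuasiIso (hcone : ConePN k StM StN φ)
    (hdM : IsHochDiffM k StM dHM) (hdN : IsHochDiffM k StN dHN)
    (hpM : IsIntDiffM k StM pdM) (hpN : IsIntDiffM k StN pdN) :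
    InducesQuasiIso StM StN dHM pdM dHN pdN φ := by
  obtain ⟨⟨C, SC, inM, inN, hC⟩, dHC, hdC, hpn⟩ := hcone
  obtain ⟨πM, πN, hπ, hπM, hπN⟩ := hC.exists_proj
  have hD := fun {n n' : ℤ} (hn : n' = n + 1) =>
    hC.totDM hdM hdN hpM hpN hdC (intDiff_isIntDiffM SC) hn
  -- A cone cocycle `(x, y)` is the boundary of a pair `(u, v)`.
  have key : ∀ {n n' : ℤ}, n' = n + 1 → ∀ (x : TotMCoch k A M) (y : TotMCoch k A N),
      TotHomogM k StM n' x → TotHomogM k StN n y → TotFinSuppM k x → TotFinSuppM k y →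
      TotIsCocycleM k dHM pdM n' x →
      (∀ p, φ.compMultilinearMap (x p) + TotDM k dHN pdN n y p = 0) →
      ∃ (u : TotMCoch k A M) (v : TotMCoch k A N),
        TotHomogM k StM n u ∧ TotHomogM k StN (n - 1) v ∧ TotFinSuppM k u ∧ TotFinSuppM k v ∧
        (∀ p, x p = -TotDM k dHM pdM n u p) ∧
        ∀ p, y p = φ.compMultilinearMap (u p) + TotDM k dHN pdN (n - 1) v p := by
    intro n n' hn x y hx hy hfx hfy hcx hcy
    obtain ⟨w, hw, hfw, hDw⟩ := hpn.totIsCoboundaryM hdC (hC.totHomogM hn hx hy)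
      ((hfx.comp (θ := inM)).add (hfy.comp (θ := inN))) (fun p => by
        rw [hD hn, hcx p, hcy p]
        ext
        simp)
    have hsplit : w = fun q => inM.compMultilinearMap (πM.compMultilinearMap (w q)) +
        inN.compMultilinearMap (πN.compMultilinearMap (w q)) := by
      funext q
      ext a
      simp [hπ]
    have hboth := fun p => hC.injective ((hDw p).trans (by
      rw [hsplit]
      exact hD (n' := n) (by ring) (fun q => πM.compMultilinearMap (w q))
        (fun q => πN.compMultilinearMap (w q)) p))
    exact ⟨_, _, hw.comp (s := -1) (fun i m hm => by simpa using hπM _ m hm) (by ring),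
      hw.comp (s := 0) (fun i m hm => by simpa using hπN _ m hm) (by ring),
      hfw.comp, hfw.comp, fun p => (hboth p).1, fun p => (hboth p).2⟩
  constructor
  · intro n c hc hfc hcc
    obtain ⟨u, v, hu, hv, hfu, hfv, hDu, hDv⟩ := key (n := n) rfl (fun _ => 0) c
      (fun p dg a ha => zero_mem _) hc ⟨0, fun _ _ => rfl⟩ hfc (fun p => totDM_zero _ p)
      (fun p => by rw [hcc p]; ext; simp)
    refine ⟨u, hu, hfu, fun p => neg_eq_zero.mp (hDu p).symm, fun q => -v q, hv.neg, hfv.neg,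
      fun p => ?_⟩
    dsimp only
    rw [totDM_neg, hDv p, sub_add_cancel_left]
  · rintro n b hb hfb hcb ⟨y, hy, hfy, hDy⟩
    obtain ⟨u, v, hu, -, hfu, -, hDu, -⟩ := key (n := n - 1) (by ring) b (fun q => -y q)
      hb hy.neg hfb hfy.neg hcb (fun p => by rw [totDM_neg, ← hDy p, add_neg_cancel])
    exact ⟨fun q => -u q, hu.neg, hfu.neg, fun p => by rw [totDM_neg, hDu p]⟩

variable {ψ : N →ₗ[k] M}

theorem InducesQuasiIso.of_rightInverse (hψq : InducesQuasiIso StN StM dHN pdN dHM pdM ψ)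
    (hφ : IsBimodHom k StM StN φ) (hψ : IsBimodHom k StN StM ψ) (hφψ : ∀ n, φ (ψ n) = n)
    (hdM : IsHochDiffM k StM dHM) (hdN : IsHochDiffM k StN dHN)
    (hpM : IsIntDiffM k StM pdM) (hpN : IsIntDiffM k StN pdN) :
    InducesQuasiIso StM StN dHM pdM dHN pdN φ := by
  have hcomp : ∀ {p : ℕ} (f : MCoch k A N p),
      φ.compMultilinearMap (ψ.compMultilinearMap f) = f := fun f => by ext; simp [hφψ]
  constructor
  · intro n c hc hfc hcc
    refine ⟨fun q => ψ.compMultilinearMap (c q), hψ.totHomogM_comp hc, hfc.comp,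
      hψ.totIsCocycleM_comp hdN hdM hpN hpM hcc, fun _ => 0, fun p dg a ha => zero_mem _,
      ⟨0, fun _ _ => rfl⟩, fun p => ?_⟩
    dsimp only
    rw [hcomp, sub_self, totDM_zero]
  · rintro n b hb hfb hcb ⟨y, hy, hfy, hDy⟩
    obtain ⟨c, -, -, -, z, hz, hfz, hDz⟩ := hψq.1 n b hb hfb hcb
    have hc : ∀ p, c p = TotDM k dHN pdN (n - 1)
        (fun q => y q + φ.compMultilinearMap (z q)) p := fun p => by
      rw [totDM_add, ← hDy, hφ.totDM_comp hdM hdN hpM hpN, ← hDz]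
      conv_lhs => rw [← hcomp (c p)]
      ext
      simp
    refine ⟨fun q => ψ.compMultilinearMap (y q + φ.compMultilinearMap (z q)) + -z q,
      (hψ.totHomogM_comp (hy.add (hφ.totHomogM_comp hz))).add hz.neg,
      (hfy.add (hfz.comp (θ := φ))).comp.add hfz.neg, fun p => ?_⟩
    rw [totDM_add, totDM_neg, hψ.totDM_comp hdN hdM hpN hpM, ← hc, ← hDz]
    dsimp only
    rw [neg_sub, add_sub_cancel]

theorem InducesQuasiIso.of_leftInverse (hψq : InducesQuasiIso StN StM dHN pdN dHM pdM ψ)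
    (hφ : IsBimodHom k StM StN φ) (hψ : IsBimodHom k StN StM ψ) (hψφ : ∀ m, ψ (φ m) = m)
    (hdM : IsHochDiffM k StM dHM) (hdN : IsHochDiffM k StN dHN)
    (hpM : IsIntDiffM k StM pdM) (hpN : IsIntDiffM k StN pdN) :
    InducesQuasiIso StM StN dHM pdM dHN pdN φ := by
  have hcomp : ∀ {p : ℕ} (f : MCoch k A M p),
      ψ.compMultilinearMap (φ.compMultilinearMap f) = f := fun f => by ext; simp [hψφ]
  constructor
  · intro n c hc hfc hcc
    have hb := hψ.totHomogM_comp hc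
    have hcb := hψ.totIsCocycleM_comp hdN hdM hpN hpM hcc
    refine ⟨fun q => ψ.compMultilinearMap (c q), hb, hfc.comp, hcb, ?_⟩
    simp only [sub_eq_add_neg]
    refine hψq.2 n _ ((hφ.totHomogM_comp hb).add hc.neg) (hfc.comp.comp.add hfc.neg)
      (fun p => ?_) ⟨fun _ => 0, fun p dg a ha => zero_mem _, ⟨0, fun _ _ => rfl⟩, fun p => ?_⟩
    · rw [totDM_add, totDM_neg, hcc p, neg_zero, add_zero]
      exact hφ.totIsCocycleM_comp hdM hdN hpM hpN hcb p
    · rw [totDM_zero]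
      ext
      simp [hψφ]
  · rintro n b hb hfb hcb ⟨y, hy, hfy, hDy⟩
    refine ⟨fun q => ψ.compMultilinearMap (y q), hψ.totHomogM_comp hy, hfy.comp, fun p => ?_⟩
    rw [hψ.totDM_comp hdN hdM hpN hpM, ← hDy, hcomp]

end QuasiIso

/-- Let `A` be a dg algebra over a field `k` of characteristic
zero and `φ : M → N` a quasi-isomorphism of dg `A`-`A`-bimodules.  If `φ` is
weakly cone-nilpotent, then the induced map
`φ_* : Hoch_⊕^•(A, M) → Hoch_⊕^•(A, N)` is a quasi-isomorphism of the sum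
Hochschild cochain complexes. -/
theorem statement8
    (k : Type) [Field k] [CharZero k]
    (A : Type) [Ring A] [Algebra k A]
    (M : Type) [AddCommGroup M] [Module k M]
    (N : Type) [AddCommGroup N] [Module k N]
    (R : KD.DGAlgebra k A) (StM : KD.DGBimod k R M) (StN : KD.DGBimod k R N)
    (dHM : ∀ (p : ℕ) (r : ℤ), KD.MCoch k A M p →ₗ[k] KD.MCoch k A M (p + 1))
    (pdM : ∀ (p : ℕ) (r : ℤ), KD.MCoch k A M p →ₗ[k] KD.MCoch k A M p)
    (dHN : ∀ (p : ℕ) (r : ℤ), KD.MCoch k A N p →ₗ[k] KD.MCoch k A N (p + 1))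
    (pdN : ∀ (p : ℕ) (r : ℤ), KD.MCoch k A N p →ₗ[k] KD.MCoch k A N p)
    (hdHM : KD.IsHochDiffM k StM dHM) (hpdM : KD.IsIntDiffM k StM pdM)
    (hdHN : KD.IsHochDiffM k StN dHN) (hpdN : KD.IsIntDiffM k StN pdN)
    (φ : M →ₗ[k] N)
    (hhom : KD.IsBimodHom k StM StN φ)
    (hqis : KD.IsQuasiIso k StM StN φ)
    (hwcn : KD.WeaklyConeNilpotent k StM StN φ) :
    -- `φ_*` is surjective on cohomology:
    (∀ (n : ℤ) (c : KD.TotMCoch k A N),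
      KD.TotHomogM k StN n c → KD.TotFinSuppM k c → KD.TotIsCocycleM k dHN pdN n c →
      ∃ b : KD.TotMCoch k A M,
        KD.TotHomogM k StM n b ∧ KD.TotFinSuppM k b ∧ KD.TotIsCocycleM k dHM pdM n b ∧
        KD.TotIsCoboundaryM k StN dHN pdN n
          (fun p => φ.compMultilinearMap (b p) - c p))
    ∧ -- `φ_*` is injective on cohomology:
    (∀ (n : ℤ) (b : KD.TotMCoch k A M),
      KD.TotHomogM k StM n b → KD.TotFinSuppM k b → KD.TotIsCocycleM k dHM pdM n b →
      KD.TotIsCoboundaryM k StN dHN pdN n (fun p => φ.compMultilinearMap (b p)) →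
      KD.TotIsCoboundaryM k StM dHM pdM n b) := by
  rcases hwcn with h | ⟨ψ, hψ, hinv, h⟩ | ⟨ψ, hψ, hinv, h⟩
  · exact h.inducesQuasiIso hdHM hdHN hpdM hpdN
  · exact (h.inducesQuasiIso hdHN hdHM hpdN hpdM).of_rightInverse hhom hψ hinv hdHM hdHN hpdM hpdN
  · exact (h.inducesQuasiIso hdHN hdHM hpdN hpdM).of_leftInverse hhom hψ hinv hdHM hdHN hpdM hpdN
end KD
end
end
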